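/- arXiv:2511.02812 — 9 statements merged into one kernel-verified Lean document; each statement's English description precedes it below -/
import Mathlib

section
/- Let γ be a ribbon. Then for every u ∈ (−u₂, u₂), the vectors γ(u) and γ'(u) in ℝ² are linearly independent. -/
open Real Set

noncomputable section

/-- Euclidean dot product on `ℝ²` (represented as `ℝ × ℝ`). -/
def dot2 (a b : ℝ × ℝ) : ℝ := a.1 * b.1 + a.2 * b.2

/-- Determinant of two vectors in `ℝ²`. -/
def det2 (a b : ℝ × ℝ) : ℝ := a.1 * b.2 - a.2 * b.1

/-- Euclidean norm on `ℝ²`. -/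
def norm2 (a : ℝ × ℝ) : ℝ := Real.sqrt (a.1 ^ 2 + a.2 ^ 2)

/-- Euclidean dot product on `ℝ³` (represented as `ℝ × ℝ × ℝ`). -/
def dot3 (a b : ℝ × ℝ × ℝ) : ℝ := a.1 * b.1 + a.2.1 * b.2.1 + a.2.2 * b.2.2

/-- Cross product on `ℝ³`. -/
def cross3 (a b : ℝ × ℝ × ℝ) : ℝ × ℝ × ℝ :=
  (a.2.1 * b.2.2 - a.2.2 * b.2.1, a.2.2 * b.1 - a.1 * b.2.2, a.1 * b.2.1 - a.2.1 * b.1)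

/-- Euclidean norm on `ℝ³`. -/
def norm3 (a : ℝ × ℝ × ℝ) : ℝ := Real.sqrt (a.1 ^ 2 + a.2.1 ^ 2 + a.2.2 ^ 2)

/-- A *ribbon*: a `C^∞` planar curve `γ : [-u₃, u₃] → ℝ²`, parametrized by arc length and
contained in the closed unit disk, which is symmetric with respect to the line `{x = y}`,
parametrizes the vertical segment `{0} × [-1, a]` on `[u₂, u₃]`, is an embedded strictly convex
arc contained in the open quadrant `(0,1) × (0,1)` on `(-u₂, u₂)`, and whose curvature
`κ = det (γ', γ'')` is strictly decreasing on `(u₁, u₂)`.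
(The curve is given as a globally defined `C^∞` map `ℝ → ℝ × ℝ`; all the geometric
conditions are imposed on `[-u₃, u₃]`.) -/
structure Ribbon where
  γ : ℝ → ℝ × ℝ
  u₁ : ℝ
  u₂ : ℝ
  u₃ : ℝ
  a : ℝ
  hu₁ : 0 < u₁
  h₁₂ : u₁ < u₂
  h₂₃ : u₂ < u₃
  ha : a ∈ Set.Ioo (0 : ℝ) 1
  hu₂u₃ : u₂ = u₃ - (1 + a)
  smooth : ContDiff ℝ (⊤ : ℕ∞) γ
  arclength : ∀ u ∈ Set.Icc (-u₃) u₃, norm2 (deriv γ u) = 1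
  inDisk : ∀ u ∈ Set.Icc (-u₃) u₃, norm2 (γ u) ≤ 1
  symm : ∀ u ∈ Set.Icc (-u₃) u₃, γ (-u) = ((γ u).2, (γ u).1)
  segment : ∀ u ∈ Set.Icc u₂ u₃, γ u = (0, a - (u - u₂))
  quadrant : ∀ u ∈ Set.Ioo (-u₂) u₂,
      (γ u).1 ∈ Set.Ioo (0 : ℝ) 1 ∧ (γ u).2 ∈ Set.Ioo (0 : ℝ) 1
  embedded : Set.InjOn γ (Set.Ioo (-u₂) u₂)
  convexArc : ∀ u ∈ Set.Ioo (-u₂) u₂, 0 < det2 (deriv γ u) (deriv (deriv γ) u)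
  curvDecreasing :
      StrictAntiOn (fun u => det2 (deriv γ u) (deriv (deriv γ) u)) (Set.Ioo u₁ u₂)

/-- A `C¹` curve has a continuous two-variable divided difference, equal to the velocity on the
diagonal. -/
theorem exists_continuous_dividedDifference {z z' : ℝ → ℂ} (hz : ∀ t, HasDerivAt z (z' t) t)
    (hz' : Continuous z') :
    ∃ H : ℝ × ℝ → ℂ, Continuous H ∧ (∀ s, H (s, s) = z' s) ∧
      ∀ s t, ((t - s : ℝ) : ℂ) * H (s, t) = z t - z s := by
  refine ⟨fun p => ∫ w in (0 : ℝ)..1, z' (p.1 + w * (p.2 - p.1)), ?_, ?_, ?_⟩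
  · exact intervalIntegral.continuous_parametric_intervalIntegral_of_continuous'
      (by unfold Function.uncurry; fun_prop) 0 1
  · intro s
    simp
  · intro s t
    have h := intervalIntegral.integral_unitInterval_deriv_eq_sub (𝕜 := ℝ) (f := z) (f' := z') (z₀ := s)
      (z₁ := t - s) (by fun_prop) (fun w _ => hz _)
    simpa using h

/-- The secant directions of an injective regular `C¹` arc admit a continuous logarithm, which
on the diagonal is a logarithm of the velocity. -/
theorem exists_continuous_log_secant {z z' : ℝ → ℂ} {l r : ℝ} (hlr : l ≤ r)
    (hz : ∀ t, HasDerivAt z (z' t) t) (hz' : Continuous z')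
    (hne : ∀ t ∈ Icc l r, z' t ≠ 0) (hinj : InjOn z (Icc l r)) :
    ∃ L : ℝ × ℝ → ℂ, Continuous L ∧ (∀ s ∈ Icc l r, Complex.exp (L (s, s)) = z' s) ∧
      ∀ s ∈ Icc l r, ∀ t ∈ Icc l r,
        ((t - s : ℝ) : ℂ) * Complex.exp (L (s, t)) = z t - z s := by
  obtain ⟨H, hHc, hHd, hH⟩ := exists_continuous_dividedDifference hz hz'
  have hH0 : ∀ s ∈ Icc l r, ∀ t ∈ Icc l r, H (s, t) ≠ 0 := by
    intro s hs t ht h0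
    have h := hH s t
    rw [h0, mul_zero, eq_comm, sub_eq_zero] at h
    obtain rfl := hinj ht hs h
    exact hne _ ht (by rw [← hHd, h0])
  let P : ℝ → ℝ := fun t => projIcc l r hlr t
  have hP : ∀ t, P t ∈ Icc l r := fun t => (projIcc l r hlr t).2
  have hPid : ∀ t ∈ Icc l r, P t = t := fun t ht => by simp [P, projIcc_of_mem hlr ht]
  have hPc : Continuous P := continuous_subtype_val.comp continuous_projIcc
  let G : C(ℝ × ℝ, ℂ) := ⟨fun p => H (P p.1, P p.2), by fun_prop⟩
  have hG0 : ∀ p, G p ∈ ({0}ᶜ : Set ℂ) := fun p => hH0 _ (hP _) _ (hP _)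
  obtain ⟨F, ⟨-, hF⟩, -⟩ := Complex.isCoveringMapOn_exp.existsUnique_continuousMap_lifts G
    (Complex.exp_log (hG0 (l, l))) hG0
  have hexp : ∀ s ∈ Icc l r, ∀ t ∈ Icc l r, Complex.exp (F (s, t)) = H (s, t) := by
    intro s hs t ht
    have h := congrFun hF (s, t)
    simpa [G, hPid s hs, hPid t ht] using h
  refine ⟨F, F.continuous, fun s hs => by rw [hexp s hs s hs, hHd], fun s hs t ht => ?_⟩
  rw [hexp s hs t ht, hH]

/-- A continuous logarithm of a differentiable function is differentiable. -/
theorem hasDerivAt_of_exp_eventuallyEq {ℓ g : ℝ → ℂ} {g' : ℂ} {u : ℝ} (hℓ : ContinuousAt ℓ u)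
    (hg : HasDerivAt g g' u) (h : ∀ᶠ v in nhds u, Complex.exp (ℓ v) = g v) :
    HasDerivAt ℓ (g' / g u) u := by
  have hu : Complex.exp (ℓ u) = g u := h.self_of_nhds
  have hgu : g u ≠ 0 := hu ▸ Complex.exp_ne_zero _
  have hlog : HasDerivAt (fun v => ℓ u + Complex.log (g v / g u)) (g' / g u) u := by
    have h1 := (hg.div_const (g u)).clog_real (by simp [hgu])
    simpa [hgu] using h1.const_add (ℓ u)
  refine hlog.congr_of_eventuallyEq ?_
  have him : Filter.Tendsto (fun v => (ℓ v - ℓ u).im) (nhds u) (nhds 0) := by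
    have : ContinuousAt (fun v => (ℓ v - ℓ u).im) u :=
      Complex.continuous_im.continuousAt.comp (hℓ.sub continuousAt_const)
    simpa [ContinuousAt] using this
  filter_upwards [h, him.eventually (Ioo_mem_nhds (neg_lt_zero.2 pi_pos) pi_pos)] with v hv hI
  rw [← hv, ← hu, ← Complex.exp_sub, Complex.log_exp hI.1 hI.2.le]
  ring

/-- A continuous function on a preconnected set that avoids the value `c` and is below `c`
somewhere is below `c` everywhere. -/
theorem lt_of_isPreconnected_of_ne {S : Set ℝ} (hS : IsPreconnected S) {f : ℝ → ℝ}
    (hf : ContinuousOn f S) {c x : ℝ} (hx : x ∈ S) (hxc : f x < c) (hne : ∀ y ∈ S, f y ≠ c) :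
    ∀ y ∈ S, f y < c := by
  intro y hy
  by_contra! hcy
  obtain ⟨w, hw, hwc⟩ := hS.intermediate_value hx hy hf ⟨hxc.le, hcy⟩
  exact hne w hw hwc

/-- Hopf's secant argument: an injective regular arc which starts horizontally to the right, stays
above its initial point and to the right of its final point, turns by at most `3π/2`. -/
theorem exists_tangentAngle_le {z z' z'' : ℝ → ℂ} {l r : ℝ} (hlr : l < r)
    (hz : ∀ t, HasDerivAt z (z' t) t) (hz' : ∀ t, HasDerivAt z' (z'' t) t)
    (hunit : ∀ t ∈ Icc l r, ‖z' t‖ = 1) (hinj : InjOn z (Icc l r)) (hl : z' l = 1)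
    (him : ∀ t ∈ Ioc l r, (z l).im < (z t).im) (hre : ∀ s ∈ Ico l r, (z r).re < (z s).re) :
    ∃ θ : ℝ → ℝ, Continuous θ ∧ θ l = 0 ∧ θ r ≤ 3 * π / 2 ∧
      (∀ t ∈ Icc l r, (z' t).re = cos (θ t) ∧ (z' t).im = sin (θ t)) ∧
      ∀ t ∈ Ioo l r, HasDerivAt θ (z'' t / z' t).im t := by
  have hz'c : Continuous z' := continuous_iff_continuousAt.2 fun t => (hz' t).continuousAt
  obtain ⟨L, hLc, hLd, hL⟩ := exists_continuous_log_secant hlr.le hz hz'c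
    (fun t ht h0 => by simpa [h0] using hunit t ht) hinj
  have hlm : l ∈ Icc l r := left_mem_Icc.2 hlr.le
  have hrm : r ∈ Icc l r := right_mem_Icc.2 hlr.le
  let M : ℝ × ℝ → ℂ := fun p => L p - L (l, l)
  have hMc : Continuous M := by fun_prop
  have hexp : ∀ p, Complex.exp (M p) = Complex.exp (L p) := fun p => by
    simp [M, Complex.exp_sub, hLd l hlm, hl]
  have hsec : ∀ s ∈ Icc l r, ∀ t ∈ Icc l r,
      ((t - s : ℝ) : ℂ) * Complex.exp (M (s, t)) = z t - z s := fun s hs t ht => by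
    rw [hexp, hL s hs t ht]
  have hdiag : ∀ s ∈ Icc l r, Complex.exp (M (s, s)) = z' s := fun s hs => by
    rw [hexp, hLd s hs]
  have hsecre : ∀ s ∈ Icc l r, ∀ t ∈ Icc l r,
      (t - s) * (Real.exp (M (s, t)).re * cos (M (s, t)).im) = (z t).re - (z s).re := by
    intro s hs t ht
    have h := congrArg Complex.re (hsec s hs t ht)
    rwa [Complex.re_ofReal_mul, Complex.exp_re, Complex.sub_re] at h
  have hsecim : ∀ s ∈ Icc l r, ∀ t ∈ Icc l r,
      (t - s) * (Real.exp (M (s, t)).re * sin (M (s, t)).im) = (z t).im - (z s).im := by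
    intro s hs t ht
    have h := congrArg Complex.im (hsec s hs t ht)
    rwa [Complex.im_ofReal_mul, Complex.exp_im, Complex.sub_im] at h
  have hMl : (M (l, l)).im = 0 := by simp [M]
  have hlower : ∀ t ∈ Icc l r, (M (l, t)).im < π := by
    refine lt_of_isPreconnected_of_ne (f := fun t => (M (l, t)).im) isPreconnected_Icc
      (Continuous.continuousOn (by fun_prop)) hlm (by simpa [hMl] using pi_pos) ?_
    intro t ht hπ
    rcases ht.1.eq_or_lt with rfl | hlt
    · simp only [hMl] at hπ
      exact pi_ne_zero hπ.symm
    · have h := hsecim l hlm t ht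
      rw [hπ, sin_pi] at h
      linarith [him t ⟨hlt, ht.2⟩]
  have hupper : ∀ s ∈ Ico l r, (M (s, r)).im < 3 * π / 2 := by
    refine lt_of_isPreconnected_of_ne (f := fun s => (M (s, r)).im) isPreconnected_Ico
      (Continuous.continuousOn (by fun_prop)) (left_mem_Ico.2 hlr)
      (by linarith [hlower r hrm, pi_pos]) ?_
    intro s hs hπ
    have h := hsecre s ⟨hs.1, hs.2.le⟩ r hrm
    rw [hπ, show 3 * π / 2 = π / 2 + π by ring, cos_add_pi, cos_pi_div_two] at h
    linarith [hre s hs]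
  have hnorm : ∀ t ∈ Icc l r, (M (t, t)).re = 0 := by
    intro t ht
    have h := hunit t ht
    rwa [← hdiag t ht, Complex.norm_exp, Real.exp_eq_one_iff] at h
  refine ⟨fun t => (M (t, t)).im, by fun_prop, hMl, ?_, fun t ht => ?_, fun t ht => ?_⟩
  · have hcl : IsClosed {s : ℝ | (M (s, r)).im ≤ 3 * π / 2} :=
      isClosed_le (by fun_prop) continuous_const
    have hsub : Ico l r ⊆ {s : ℝ | (M (s, r)).im ≤ 3 * π / 2} := fun s hs => (hupper s hs).le
    exact hcl.closure_subset_iff.2 hsub (by rw [closure_Ico hlr.ne]; exact hrm)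
  · rw [← hdiag t ht, Complex.exp_re, Complex.exp_im, hnorm t ht]
    simp
  · have hev : ∀ᶠ v in nhds t, Complex.exp (M (v, v)) = z' v :=
      Filter.mem_of_superset (Icc_mem_nhds ht.1 ht.2) fun v hv => hdiag v hv
    have h := hasDerivAt_of_exp_eventuallyEq (ℓ := fun v => M (v, v))
      (Continuous.continuousAt (by fun_prop)) (hz' t) hev
    exact Complex.imCLM.hasFDerivAt.comp_hasDerivAt t h

/-- If a plane arc stays in the open first quadrant, turns left, and its tangent angle increases
from `0` on the `x`-axis to at most `3π/2` on the `y`-axis, then its polar angle is strictly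
increasing. -/
theorem det_position_velocity_pos {x y x' y' x'' y'' θ : ℝ → ℝ} {l r : ℝ}
    (hx : ∀ t, HasDerivAt x (x' t) t) (hy : ∀ t, HasDerivAt y (y' t) t)
    (hx' : ∀ t, HasDerivAt x' (x'' t) t) (hy' : ∀ t, HasDerivAt y' (y'' t) t)
    (hxpos : ∀ t ∈ Ioo l r, 0 < x t) (hypos : ∀ t ∈ Ioo l r, 0 < y t)
    (hκ : ∀ t ∈ Ioo l r, 0 < x' t * y'' t - y' t * x'' t)
    (horth : ∀ t ∈ Ioo l r, x' t * x'' t + y' t * y'' t = 0)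
    (hθ : StrictMonoOn θ (Icc l r)) (hθl : θ l = 0) (hθr : θ r ≤ 3 * π / 2)
    (hxθ : ∀ t ∈ Icc l r, x' t = cos (θ t)) (hyθ : ∀ t ∈ Icc l r, y' t = sin (θ t))
    (hfl : x l * y' l - y l * x' l = 0) (hfr : x r * y' r - y r * x' r = 0) :
    ∀ t ∈ Ioo l r, 0 < x t * y' t - y t * x' t := by
  intro u hu
  have hlm : l ∈ Icc l r := ⟨le_rfl, (hu.1.trans hu.2).le⟩
  have hrm : r ∈ Icc l r := ⟨(hu.1.trans hu.2).le, le_rfl⟩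
  have hum : u ∈ Icc l r := Ioo_subset_Icc_self hu
  have hf : ∀ t, HasDerivAt (fun t => x t * y' t - y t * x' t) (x t * y'' t - y t * x'' t) t := by
    intro t
    have h := ((hx t).mul (hy' t)).sub ((hy t).mul (hx' t))
    convert! h using 1
    ring
  have hfc : Continuous fun t => x t * y' t - y t * x' t :=
    continuous_iff_continuousAt.2 fun t => (hf t).continuousAt
  have hfκ : ∀ t ∈ Ioo l r, x t * y'' t - y t * x'' t =
      (x' t * y'' t - y' t * x'' t) * (x t * x' t + y t * y' t) := by
    intro t ht
    have h1 : x' t ^ 2 + y' t ^ 2 = 1 := by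
      rw [hxθ t (Ioo_subset_Icc_self ht), hyθ t (Ioo_subset_Icc_self ht)]
      exact cos_sq_add_sin_sq _
    linear_combination (y t * x'' t - x t * y'' t) * h1 + (x t * y' t - y t * x' t) * horth t ht
  have h0 : 0 < θ u := hθl ▸ hθ hlm hum hu.1
  have h3 : θ u < 3 * π / 2 := (hθ hum hrm hu.2).trans_le hθr
  rcases lt_or_ge (θ u) (π / 2) with h1 | h1
  · have hmono : StrictMonoOn (fun t => x t * y' t - y t * x' t) (Icc l u) := by
      refine strictMonoOn_of_deriv_pos (convex_Icc _ _) hfc.continuousOn fun t ht => ?_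
      rw [interior_Icc] at ht
      have htr : t ∈ Ioo l r := ⟨ht.1, ht.2.trans hu.2⟩
      have htm := Ioo_subset_Icc_self htr
      have ht0 : 0 < θ t := hθl ▸ hθ hlm htm ht.1
      have ht1 : θ t < θ u := hθ htm hum ht.2
      rw [(hf t).deriv, hfκ t htr, hxθ t htm, hyθ t htm]
      have hc : 0 < cos (θ t) := cos_pos_of_mem_Ioo ⟨by linarith, by linarith⟩
      have hs : 0 < sin (θ t) := sin_pos_of_pos_of_lt_pi ht0 (by linarith)
      have hk := hκ t htr
      rw [hxθ t htm, hyθ t htm] at hk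
      exact mul_pos hk (add_pos (mul_pos (hxpos t htr) hc) (mul_pos (hypos t htr) hs))
    have h := hmono (left_mem_Icc.2 hu.1.le) (right_mem_Icc.2 hu.1.le) hu.1
    simpa only [hfl] using h
  rcases le_or_gt (θ u) π with h2 | h2
  · rw [hxθ u hum, hyθ u hum]
    have hc : cos (θ u) ≤ 0 := cos_nonpos_of_pi_div_two_le_of_le h1 (by linarith)
    have hs : 0 ≤ sin (θ u) := sin_nonneg_of_nonneg_of_le_pi h0.le h2
    rcases hs.eq_or_lt with hs0 | hs0
    · have hc0 : cos (θ u) < 0 := by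
        refine lt_of_le_of_ne hc fun hc0 => ?_
        have := sin_sq_add_cos_sq (θ u)
        rw [← hs0, hc0] at this
        norm_num at this
      rw [← hs0]
      linarith [mul_neg_of_pos_of_neg (hypos u hu) hc0]
    · nlinarith [mul_pos (hxpos u hu) hs0, mul_nonneg (hypos u hu).le (neg_nonneg.2 hc)]
  · have hanti : StrictAntiOn (fun t => x t * y' t - y t * x' t) (Icc u r) := by
      refine strictAntiOn_of_deriv_neg (convex_Icc _ _) hfc.continuousOn fun t ht => ?_
      rw [interior_Icc] at ht
      have htr : t ∈ Ioo l r := ⟨hu.1.trans ht.1, ht.2⟩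
      have htm := Ioo_subset_Icc_self htr
      have ht0 : θ u < θ t := hθ hum htm ht.1
      have ht1 : θ t < 3 * π / 2 := (hθ htm hrm ht.2).trans_le hθr
      rw [(hf t).deriv, hfκ t htr, hxθ t htm, hyθ t htm]
      have hc : cos (θ t) < 0 := cos_neg_of_pi_div_two_lt_of_lt (by linarith) (by linarith)
      have hs : sin (θ t) < 0 := by
        have := sin_pos_of_pos_of_lt_pi (x := θ t - π) (by linarith) (by linarith)
        rw [sin_sub_pi] at this
        linarith
      have hk := hκ t htr
      rw [hxθ t htm, hyθ t htm] at hk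
      exact mul_neg_of_pos_of_neg hk (add_neg (mul_neg_of_pos_of_neg (hxpos t htr) hc)
        (mul_neg_of_pos_of_neg (hypos t htr) hs))
    have h := hanti (left_mem_Icc.2 hu.2.le) (right_mem_Icc.2 hu.2.le) hu.2
    simpa only [hfr] using h

/-- Two plane vectors with nonzero determinant are linearly independent. -/
theorem linearIndependent_of_det2_ne_zero {p q : ℝ × ℝ} (h : det2 p q ≠ 0) :
    LinearIndependent ℝ ![p, q] := by
  rw [LinearIndependent.pair_iff]
  intro s t hst
  have h1 : s * p.1 + t * q.1 = 0 := congrArg Prod.fst hst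
  have h2 : s * p.2 + t * q.2 = 0 := congrArg Prod.snd hst
  unfold det2 at h
  constructor
  · refine (mul_eq_zero.1 (?_ : s * (p.1 * q.2 - p.2 * q.1) = 0)).resolve_right h
    linear_combination q.2 * h1 - q.1 * h2
  · refine (mul_eq_zero.1 (?_ : t * (p.1 * q.2 - p.2 * q.1) = 0)).resolve_right h
    linear_combination p.1 * h2 - p.2 * h1

/-- A differentiable function which is affine on a nondegenerate closed interval has the slope of
that affine function as its derivative at each point of the interval. -/
theorem HasDerivAt.eq_of_eqOn_Icc_affine {f : ℝ → ℝ} {f' c d p q u : ℝ} (hf : HasDerivAt f f' u)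
    (hpq : p < q) (hu : u ∈ Icc p q) (h : ∀ v ∈ Icc p q, f v = c * v + d) : f' = c := by
  have haff : HasDerivAt (fun v : ℝ => c * v + d) c u := by
    simpa using ((hasDerivAt_id u).const_mul c).add_const d
  exact (uniqueDiffOn_Icc hpq u hu).eq_deriv _ hf.hasDerivWithinAt
    (haff.hasDerivWithinAt.congr h (h u hu))

/-- **Lemma (Lemma 2.3).** For a ribbon `γ`, the vectors `γ(u)` and `γ'(u)` are linearly
independent for every `u ∈ (-u₂, u₂)`. -/
theorem ribbon_position_tangent_linearIndependent (Rb : Ribbon) :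
    ∀ u ∈ Set.Ioo (-Rb.u₂) Rb.u₂,
      LinearIndependent ℝ ![Rb.γ u, deriv Rb.γ u] := by
  obtain ⟨γ, u₁, u₂, u₃, a, hu₁, h₁₂, h₂₃, ha, -, hsm, harc, -, hsymm, hseg, hquad, hemb, hconv,
    -⟩ := Rb
  intro u hu
  have hu₂ : 0 < u₂ := hu₁.trans h₁₂
  let x : ℝ → ℝ := fun t => (γ t).1
  let y : ℝ → ℝ := fun t => (γ t).2
  let x' : ℝ → ℝ := fun t => (deriv γ t).1
  let y' : ℝ → ℝ := fun t => (deriv γ t).2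
  let x'' : ℝ → ℝ := fun t => (deriv (deriv γ) t).1
  let y'' : ℝ → ℝ := fun t => (deriv (deriv γ) t).2
  have hγ : ∀ t, HasDerivAt γ (deriv γ t) t := fun t =>
    (hsm.differentiable (by simp) t).hasDerivAt
  have hγ' : ∀ t, HasDerivAt (deriv γ) (deriv (deriv γ) t) t := fun t =>
    (((contDiff_infty_iff_deriv.1 hsm).2).differentiable (by simp) t).hasDerivAt
  have hx : ∀ t, HasDerivAt x (x' t) t := fun t => (hγ t).fst
  have hy : ∀ t, HasDerivAt y (y' t) t := fun t => (hγ t).snd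
  have hx' : ∀ t, HasDerivAt x' (x'' t) t := fun t => (hγ' t).fst
  have hy' : ∀ t, HasDerivAt y' (y'' t) t := fun t => (hγ' t).snd
  have hsub : Icc (-u₂) u₂ ⊆ Icc (-u₃) u₃ := Icc_subset_Icc (neg_le_neg h₂₃.le) h₂₃.le
  have hunit : ∀ t ∈ Icc (-u₂) u₂, x' t ^ 2 + y' t ^ 2 = 1 := fun t ht => by
    simpa [norm2] using harc t (hsub ht)
  have hκ : ∀ t ∈ Ioo (-u₂) u₂, 0 < x' t * y'' t - y' t * x'' t := hconv
  have horth : ∀ t ∈ Ioo (-u₂) u₂, x' t * x'' t + y' t * y'' t = 0 := by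
    intro t ht
    have h1 := ((hx' t).pow 2).add ((hy' t).pow 2)
    have h2 : (fun v => x' v ^ 2 + y' v ^ 2) =ᶠ[nhds t] fun _ => (1 : ℝ) :=
      Filter.mem_of_superset (Icc_mem_nhds ht.1 ht.2) hunit
    have h3 := h1.unique ((hasDerivAt_const t (1 : ℝ)).congr_of_eventuallyEq h2)
    norm_num at h3
    linarith
  have hfinal : ∀ v ∈ Icc u₂ u₃, x v = 0 ∧ y v = a - (v - u₂) := fun v hv => by
    simp [x, y, hseg v hv]
  have hinitial : ∀ v ∈ Icc (-u₃) (-u₂), x v = a + v + u₂ ∧ y v = 0 := fun v hv => by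
    have hv' : -v ∈ Icc u₂ u₃ := ⟨by linarith [hv.2], by linarith [hv.1]⟩
    have h := hsymm (-v) ⟨by linarith [hv'.1], hv'.2⟩
    rw [hseg _ hv', neg_neg] at h
    simp only [x, y, h, and_true]
    ring
  have hl3 : -u₂ ∈ Icc (-u₃) (-u₂) := ⟨by linarith, le_rfl⟩
  have hr3 : u₂ ∈ Icc u₂ u₃ := ⟨le_rfl, h₂₃.le⟩
  obtain ⟨hxl, hyl⟩ := hinitial _ hl3
  obtain ⟨hxr, hyr⟩ := hfinal _ hr3
  have hxl : x (-u₂) = a := by rw [hxl]; ring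
  have hyr : y u₂ = a := by rw [hyr]; ring
  have hx'l : x' (-u₂) = 1 := (hx _).eq_of_eqOn_Icc_affine (neg_lt_neg h₂₃) hl3
    (d := a + u₂) fun v hv => by rw [(hinitial v hv).1]; ring
  have hy'l : y' (-u₂) = 0 := (hy _).eq_of_eqOn_Icc_affine (neg_lt_neg h₂₃) hl3
    (d := 0) fun v hv => by rw [(hinitial v hv).2]; ring
  have hx'r : x' u₂ = 0 := (hx _).eq_of_eqOn_Icc_affine h₂₃ hr3
    (d := 0) fun v hv => by rw [(hfinal v hv).1]; ring
  have hxpos : ∀ t ∈ Ico (-u₂) u₂, 0 < x t := fun t ht => by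
    rcases ht.1.eq_or_lt with rfl | h
    · rw [hxl]; exact ha.1
    · exact (hquad t ⟨h, ht.2⟩).1.1
  have hypos : ∀ t ∈ Ioc (-u₂) u₂, 0 < y t := fun t ht => by
    rcases ht.2.eq_or_lt with rfl | h
    · rw [hyr]; exact ha.1
    · exact (hquad t ⟨ht.1, h⟩).2.1
  have hinj : InjOn γ (Icc (-u₂) u₂) := by
    intro s hs t ht hst
    have hxst : x s = x t := congrArg Prod.fst hst
    have hyst : y s = y t := congrArg Prod.snd hst
    rcases hs.2.eq_or_lt with rfl | hs2
    · by_contra hne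
      linarith [hxpos t ⟨ht.1, lt_of_le_of_ne ht.2 (Ne.symm hne)⟩]
    rcases ht.2.eq_or_lt with rfl | ht2
    · linarith [hxpos s ⟨hs.1, hs2⟩]
    rcases hs.1.eq_or_lt with rfl | hs1
    · by_contra hne
      linarith [hypos t ⟨lt_of_le_of_ne ht.1 hne, ht2.le⟩]
    rcases ht.1.eq_or_lt with rfl | ht1
    · linarith [hypos s ⟨hs1, hs2.le⟩]
    exact hemb ⟨hs1, hs2⟩ ⟨ht1, ht2⟩ hst
  have hcomplex : ∀ {f g f' g' : ℝ → ℝ}, (∀ t, HasDerivAt f (f' t) t) →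
      (∀ t, HasDerivAt g (g' t) t) →
      ∀ t, HasDerivAt (fun v => (f v : ℂ) + g v * Complex.I) (f' t + g' t * Complex.I) t :=
    fun hf hg t => (hf t).ofReal_comp.add ((hg t).ofReal_comp.mul_const _)
  obtain ⟨θ, hθc, hθl, hθr, hθ, hθ'⟩ := exists_tangentAngle_le
    (show -u₂ < u₂ by linarith) (hcomplex hx hy) (hcomplex hx' hy')
    (fun t ht => by
      rw [Complex.norm_add_mul_I, hunit t ht, sqrt_one])
    (fun s hs t ht hst => hinj hs ht (Prod.ext
      (by simpa using congrArg Complex.re hst) (by simpa using congrArg Complex.im hst)))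
    (by simp [hx'l, hy'l])
    (fun t ht => by simpa [hyl] using hypos t ht)
    (fun s hs => by simpa [hxr] using hxpos s hs)
  have hxθ : ∀ t ∈ Icc (-u₂) u₂, x' t = cos (θ t) := fun t ht => by simpa using (hθ t ht).1
  have hyθ : ∀ t ∈ Icc (-u₂) u₂, y' t = sin (θ t) := fun t ht => by simpa using (hθ t ht).2
  have hmono : StrictMonoOn θ (Icc (-u₂) u₂) := by
    refine strictMonoOn_of_deriv_pos (convex_Icc _ _) hθc.continuousOn fun t ht => ?_
    rw [interior_Icc] at ht
    rw [(hθ' t ht).deriv]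
    have hn := hunit t (Ioo_subset_Icc_self ht)
    have := hκ t ht
    simp only [Complex.div_im, Complex.normSq_add_mul_I, hn]
    simp
    linarith
  have hpos := det_position_velocity_pos hx hy hx' hy'
    (fun t ht => hxpos t ⟨ht.1.le, ht.2⟩) (fun t ht => hypos t ⟨ht.1, ht.2.le⟩)
    hκ horth hmono hθl hθr hxθ hyθ (by rw [hyl, hy'l]; ring) (by rw [hxr, hx'r]; ring) u hu
  exact linearIndependent_of_det2_ne_zero hpos.ne'
end
end

section
/- Let a > 0 and let f : [0, 3π/4] → ℝ be continuous with f(ν) > 0 for all ν. Define γ(θ) = (γ₁(θ), γ₂(θ)) = (a + ∫₀^θ f(ν) cos ν dν, ∫₀^θ f(ν) sin ν dν), and assume that γ₁(θ) > 0 for every θ ∈ (π/2, 3π/4]. Then F(θ) := sin θ · γ₁(θ) − cos θ · γ₂(θ) > 0 for every θ ∈ (0, 3π/4]. In particular, γ(θ) and γ'(θ) = f(θ)(cos θ, sin θ) are linearly independent for θ ∈ (0, 3π/4]. -/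
open Real Set

/-- Expanding `sin (θ - ν)` under the integral sign. -/
theorem sin_mul_integral_cos_sub_cos_mul_integral_sin {f : ℝ → ℝ} {b c : ℝ}
    (hf : ContinuousOn f (Set.uIcc b c)) (θ : ℝ) :
    Real.sin θ * (∫ ν in b..c, f ν * Real.cos ν) - Real.cos θ * (∫ ν in b..c, f ν * Real.sin ν) =
      ∫ ν in b..c, f ν * Real.sin (θ - ν) := by
  have hcos : IntervalIntegrable (fun ν => f ν * Real.cos ν) MeasureTheory.volume b c :=
    (hf.mul Real.continuous_cos.continuousOn).intervalIntegrable
  have hsin : IntervalIntegrable (fun ν => f ν * Real.sin ν) MeasureTheory.volume b c :=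
    (hf.mul Real.continuous_sin.continuousOn).intervalIntegrable
  rw [← intervalIntegral.integral_const_mul, ← intervalIntegral.integral_const_mul,
    ← intervalIntegral.integral_sub (hcos.const_mul _) (hsin.const_mul _)]
  congr 1 with ν
  rw [Real.sin_sub]
  ring

/-- A plane vector with nonzero determinant against `(cos θ, sin θ)` is linearly independent of
every nonzero multiple of it. -/
theorem linearIndependent_pair_smul_cos_sin {x y r θ : ℝ} (hr : r ≠ 0)
    (h : Real.sin θ * x - Real.cos θ * y ≠ 0) :
    LinearIndependent ℝ ![((x, y) : ℝ × ℝ), (r * Real.cos θ, r * Real.sin θ)] := by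
  rw [LinearIndependent.pair_iff]
  intro s t hst
  simp only [Prod.smul_mk, smul_eq_mul, Prod.mk_add_mk, Prod.mk_eq_zero] at hst
  obtain ⟨h₁, h₂⟩ := hst
  have hs : s = 0 := by
    have : s * (Real.sin θ * x - Real.cos θ * y) = 0 := by
      linear_combination Real.sin θ * h₁ - Real.cos θ * h₂
    exact (mul_eq_zero.mp this).resolve_right h
  refine ⟨hs, ?_⟩
  subst hs
  have : t * r = 0 := by
    linear_combination Real.cos θ * h₁ + Real.sin θ * h₂ - t * r * Real.sin_sq_add_cos_sq θ
  exact (mul_eq_zero.mp this).resolve_right hr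

/-- Key step in Lemma 2.3: a strictly convex planar arc emanating from `(a,0)` with initial
tangent `(1,0)`, reparametrized by its tangent angle `θ`, is nowhere radial:
`F(θ) = sin θ · γ₁(θ) - cos θ · γ₂(θ) > 0` on `(0, 3π/4]`, and consequently `γ(θ)` and
`γ'(θ) = f(θ)(cos θ, sin θ)` are linearly independent there. -/
theorem convex_arc_nowhere_radial (a : ℝ) (ha : 0 < a) (f : ℝ → ℝ)
    (hf : ContinuousOn f (Set.Icc 0 (3 * π / 4)))
    (hfpos : ∀ ν ∈ Set.Icc (0 : ℝ) (3 * π / 4), 0 < f ν)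
    (γ₁ γ₂ : ℝ → ℝ)
    (hγ₁ : ∀ θ, γ₁ θ = a + ∫ ν in (0 : ℝ)..θ, f ν * Real.cos ν)
    (hγ₂ : ∀ θ, γ₂ θ = ∫ ν in (0 : ℝ)..θ, f ν * Real.sin ν)
    (hpos : ∀ θ ∈ Set.Ioc (π / 2) (3 * π / 4), 0 < γ₁ θ) :
    ∀ θ ∈ Set.Ioc (0 : ℝ) (3 * π / 4),
      0 < Real.sin θ * γ₁ θ - Real.cos θ * γ₂ θ ∧
      LinearIndependent ℝ
        ![((γ₁ θ, γ₂ θ) : ℝ × ℝ), (f θ * Real.cos θ, f θ * Real.sin θ)] := by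
  rintro θ ⟨hθ₀, hθ⟩
  have hπ := Real.pi_pos
  have hF : 0 < Real.sin θ * γ₁ θ - Real.cos θ * γ₂ θ := by
    have hcont : ContinuousOn f (Set.uIcc 0 θ) := by
      rw [Set.uIcc_of_le hθ₀.le]
      exact hf.mono (Set.Icc_subset_Icc_right hθ)
    have hint : 0 ≤ ∫ ν in (0 : ℝ)..θ, f ν * Real.sin (θ - ν) := by
      refine intervalIntegral.integral_nonneg hθ₀.le fun ν hν => ?_
      exact mul_nonneg (hfpos ν ⟨hν.1, hν.2.trans hθ⟩).le
        (Real.sin_nonneg_of_nonneg_of_le_pi (by linarith [hν.2]) (by linarith [hν.1]))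
    have hsin : 0 < a * Real.sin θ :=
      mul_pos ha (Real.sin_pos_of_pos_of_lt_pi hθ₀ (by linarith))
    have key := sin_mul_integral_cos_sub_cos_mul_integral_sin hcont θ
    rw [hγ₁, hγ₂]
    linarith
  exact ⟨hF, linearIndependent_pair_smul_cos_sin (hfpos θ ⟨hθ₀.le, hθ⟩).ne' hF.ne'⟩
end

section
/- Fix p ∈ ℝ² with 0 < ‖p‖ < 1, set R = (1/‖p‖ − ‖p‖)/2, and define c : ℝ → ℝ³ by c(v) = (F(v)·p, R sin(v/R)) where F(v) = 1 + (R/‖p‖)(1 − cos(v/R)). Then: (i) c(0) = (p, 0) and c'(0) = (0,0,1); (ii) ‖c'(v)‖ = 1 for every v ∈ ℝ (c is parametrized by arc length); (iii) ‖c(v) − ((1 + R/‖p‖)p, 0)‖ = R for every v ∈ ℝ, i.e. c parametrizes the circle of radius R centered at the point (1 + R/‖p‖)p of the horizontal plane, contained in the vertical plane through the origin and (p,0). -/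
open Real Set

noncomputable section

/-- The derivative of `v ↦ ((1 + (R/n)(1 - cos (v/R))) p, R sin (v/R))`. -/
lemma hasDerivAt_circle_curve (p : ℝ × ℝ) (n : ℝ) {R : ℝ} (hR : R ≠ 0) (v : ℝ) :
    HasDerivAt
      (fun v : ℝ => ((1 + R / n * (1 - Real.cos (v / R))) * p.1,
        (1 + R / n * (1 - Real.cos (v / R))) * p.2, R * Real.sin (v / R)))
      (Real.sin (v / R) / n * p.1, Real.sin (v / R) / n * p.2, Real.cos (v / R)) v := by
  have hdiv : HasDerivAt (fun v : ℝ => v / R) (1 / R) v := (hasDerivAt_id v).div_const R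
  have hF : HasDerivAt (fun v : ℝ => 1 + R / n * (1 - Real.cos (v / R)))
      (Real.sin (v / R) / n) v := by
    refine (((hdiv.cos.const_sub 1).const_mul (R / n)).const_add 1).congr_deriv ?_
    field_simp
  have hs : HasDerivAt (fun v : ℝ => R * Real.sin (v / R)) (Real.cos (v / R)) v := by
    refine (hdiv.sin.const_mul R).congr_deriv ?_
    field_simp
  exact (hF.mul_const p.1).prodMk ((hF.mul_const p.2).prodMk hs)

/-- The curve `c(v) = (F(v)·p, R sin(v/R))`, with `R = (1/‖p‖ - ‖p‖)/2` and
`F(v) = 1 + (R/‖p‖)(1 - cos(v/R))`, satisfies: (i) `c(0) = (p,0)` and `c'(0) = (0,0,1)`;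
(ii) `c` is parametrized by arc length; (iii) `c` parametrizes the circle of radius `R`
centered at `((1 + R/‖p‖)p, 0)`. -/
theorem circle_curve_properties (p : ℝ × ℝ) (hp0 : 0 < norm2 p) (hp1 : norm2 p < 1)
    (R : ℝ) (hR : R = (1 / norm2 p - norm2 p) / 2)
    (F : ℝ → ℝ) (hF : ∀ v, F v = 1 + (R / norm2 p) * (1 - Real.cos (v / R)))
    (c : ℝ → ℝ × ℝ × ℝ)
    (hc : ∀ v, c v = (F v * p.1, F v * p.2, R * Real.sin (v / R))) :
    (c 0 = (p.1, p.2, 0) ∧ deriv c 0 = (0, 0, 1)) ∧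
    (∀ v : ℝ, norm3 (deriv c v) = 1) ∧
    (∀ v : ℝ,
      norm3 (c v - ((1 + R / norm2 p) * p.1, (1 + R / norm2 p) * p.2, 0)) = R) := by
  have hn0 : norm2 p ≠ 0 := hp0.ne'
  have hsq : p.1 ^ 2 + p.2 ^ 2 = norm2 p ^ 2 := (Real.sq_sqrt (by positivity)).symm
  have hRpos : 0 < R := by
    have := one_lt_one_div hp0 hp1
    linarith
  have hderiv (v : ℝ) : deriv c v =
      (Real.sin (v / R) / norm2 p * p.1, Real.sin (v / R) / norm2 p * p.2, Real.cos (v / R)) := by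
    have hceq : c = fun v => ((1 + R / norm2 p * (1 - Real.cos (v / R))) * p.1,
        (1 + R / norm2 p * (1 - Real.cos (v / R))) * p.2, R * Real.sin (v / R)) := by
      funext v
      rw [hc, hF]
    rw [hceq]
    exact (hasDerivAt_circle_curve p (norm2 p) hRpos.ne' v).deriv
  refine ⟨⟨by simp [hc, hF], by simp [hderiv]⟩, fun v => ?_, fun v => ?_⟩
  · rw [hderiv, norm3, Real.sqrt_eq_one]
    calc _ = Real.sin (v / R) ^ 2 / norm2 p ^ 2 * (p.1 ^ 2 + p.2 ^ 2)
          + Real.cos (v / R) ^ 2 := by ring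
      _ = 1 := by
        rw [hsq, div_mul_cancel₀ _ (pow_ne_zero 2 hn0), Real.sin_sq_add_cos_sq]
  · rw [hc, hF, norm3, Real.sqrt_eq_iff_eq_sq (by positivity) hRpos.le]
    simp only [Prod.fst_sub, Prod.snd_sub]
    calc _ = R ^ 2 * Real.cos (v / R) ^ 2 / norm2 p ^ 2 * (p.1 ^ 2 + p.2 ^ 2)
          + R ^ 2 * Real.sin (v / R) ^ 2 := by ring
      _ = R ^ 2 := by
        rw [hsq, div_mul_cancel₀ _ (pow_ne_zero 2 hn0), ← mul_add, Real.cos_sq_add_sin_sq, mul_one]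
end
end

section
/- Fix p ∈ ℝ² with 0 < ‖p‖ < 1, set R = (1/‖p‖ − ‖p‖)/2, and define c : ℝ → ℝ³ by c(v) = (F(v)·p, R sin(v/R)) where F(v) = 1 + (R/‖p‖)(1 − cos(v/R)). Then for every v ∈ ℝ with ‖c(v)‖ = 1, the vectors c(v) and c'(v) in ℝ³ are linearly dependent. (That is, at every point where the circle parametrized by c meets the unit sphere, its tangent line is radial, so the circle meets the unit sphere orthogonally.) -/
open Real Set

noncomputable section

/-- The circle of radius `R = (1 / n - n) / 2` centred at distance `n + R` from the origin meets the
unit circle only at angles whose cosine is `R / (n + R)`. -/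
lemma add_mul_cos_eq_of_norm_eq_one {n R C S : ℝ} (hn0 : 0 < n) (hn1 : n < 1)
    (hR : R = (1 / n - n) / 2) (hCS : S ^ 2 + C ^ 2 = 1)
    (h : (n + R * (1 - C)) ^ 2 + (R * S) ^ 2 = 1) : 0 < R ∧ (n + R) * C = R := by
  have hnR : 2 * n * R = 1 - n ^ 2 := by rw [hR]; field_simp
  have hRpos : 0 < R := by
    have : 0 < 2 * n * R := by nlinarith
    exact pos_of_mul_pos_right this (by positivity)
  refine ⟨hRpos, mul_left_cancel₀ hRpos.ne' ?_⟩
  linear_combination (-1 / 2) * h + (1 / 2) * hnR + (1 / 2) * R ^ 2 * hCS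

/-- At every point where the circle parametrized by `c` meets the unit sphere, its tangent
line is radial: `c(v)` and `c'(v)` are linearly dependent whenever `‖c(v)‖ = 1`. -/
theorem circle_meets_sphere_orthogonally (p : ℝ × ℝ) (hp0 : 0 < norm2 p) (hp1 : norm2 p < 1)
    (R : ℝ) (hR : R = (1 / norm2 p - norm2 p) / 2)
    (F : ℝ → ℝ) (hF : ∀ v, F v = 1 + (R / norm2 p) * (1 - Real.cos (v / R)))
    (c : ℝ → ℝ × ℝ × ℝ)
    (hc : ∀ v, c v = (F v * p.1, F v * p.2, R * Real.sin (v / R))) :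
    ∀ v : ℝ, norm3 (c v) = 1 → ¬ LinearIndependent ℝ ![c v, deriv c v] := by
  intro v hv hli
  have hsq : norm2 p ^ 2 = p.1 ^ 2 + p.2 ^ 2 := Real.sq_sqrt (by positivity)
  set n := norm2 p
  set C := Real.cos (v / R) with hC
  set S := Real.sin (v / R) with hS
  have hCS : S ^ 2 + C ^ 2 = 1 := Real.sin_sq_add_cos_sq _
  have hFn : F v * n = n + R * (1 - C) := by rw [hF, ← hC]; field_simp
  have hnorm : (n + R * (1 - C)) ^ 2 + (R * S) ^ 2 = 1 := by
    rw [norm3, hc, Real.sqrt_eq_one] at hv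
    rw [← hFn]
    linear_combination hv + F v ^ 2 * hsq
  obtain ⟨hRpos, hcos⟩ := add_mul_cos_eq_of_norm_eq_one hp0 hp1 hR hCS hnorm
  have hC0 : C ≠ 0 := right_ne_zero_of_mul (hcos.trans_ne hRpos.ne')
  have hdiv : HasDerivAt (fun t : ℝ => t / R) (1 / R) v := (hasDerivAt_id v).div_const R
  have hFd : HasDerivAt F (S / n) v := by
    rw [funext hF]
    refine (((hdiv.cos.const_sub 1).const_mul (R / n)).const_add 1).congr_deriv ?_
    rw [← hS]
    field_simp
  have hsin : HasDerivAt (fun t => R * Real.sin (t / R)) C v := by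
    refine (hdiv.sin.const_mul R).congr_deriv ?_
    rw [← hC]
    field_simp
  have hcd : HasDerivAt c (S / n * p.1, S / n * p.2, C) v := by
    rw [funext hc]
    exact (hFd.mul_const p.1).prodMk ((hFd.mul_const p.2).prodMk hsin)
  rw [hcd.deriv, hc, LinearIndependent.pair_iff] at hli
  have hrad : C * F v - R * S * (S / n) = 0 := by
    field_simp
    linear_combination C * hFn + hcos - R * hCS
  refine hC0 (hli C (-(R * S)) ?_).1
  ext
  · simp only [Prod.smul_mk, Prod.mk_add_mk, smul_eq_mul, Prod.fst_zero]
    linear_combination p.1 * hrad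
  · simp only [Prod.smul_mk, Prod.mk_add_mk, smul_eq_mul, Prod.fst_zero, Prod.snd_zero]
    linear_combination p.2 * hrad
  · simp only [Prod.smul_mk, Prod.mk_add_mk, smul_eq_mul, Prod.snd_zero]
    ring
end
end

section
/- Fix p ∈ ℝ² with 0 < ‖p‖ < 1, set R = (1/‖p‖ − ‖p‖)/2, and define c : ℝ → ℝ³ by c(v) = (F(v)·p, R sin(v/R)) where F(v) = 1 + (R/‖p‖)(1 − cos(v/R)). Then: (i) d/dv ‖c(v)‖² = 2(‖p‖ + R) sin(v/R), so v ↦ ‖c(v)‖ is strictly increasing on [0, πR]; (ii) ‖c(0)‖ = ‖p‖ < 1 and ‖c(πR)‖ = 1/‖p‖ > 1; (iii) consequently there exists a unique v_p ∈ (0, πR) with ‖c(v_p)‖ = 1, and ‖c(v)‖ < 1 for every v with |v| < v_p while ‖c(±v_p)‖ = 1 (using that ‖c(−v)‖ = ‖c(v)‖). -/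
open Real Set

noncomputable section

/-- The squared norm of the point at angle `t` on the circle of radius `R` which starts at `(p, 0)`
and lies in the vertical plane through the origin and `p`. -/
theorem circle_normSq (p : ℝ × ℝ) (hp : 0 < norm2 p) (R t : ℝ) :
    ((1 + R / norm2 p * (1 - cos t)) * p.1) ^ 2 + ((1 + R / norm2 p * (1 - cos t)) * p.2) ^ 2 +
        (R * sin t) ^ 2 =
      norm2 p ^ 2 + 2 * R * (norm2 p + R) * (1 - cos t) := by
  have hsq : p.1 ^ 2 + p.2 ^ 2 = norm2 p ^ 2 := (sq_sqrt (by positivity)).symm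
  have hF : (1 + R / norm2 p * (1 - cos t)) * norm2 p = norm2 p + R * (1 - cos t) := by
    field_simp
  calc
    _ = (1 + R / norm2 p * (1 - cos t)) ^ 2 * (p.1 ^ 2 + p.2 ^ 2) + R ^ 2 * sin t ^ 2 := by ring
    _ = ((1 + R / norm2 p * (1 - cos t)) * norm2 p) ^ 2 + R ^ 2 * sin t ^ 2 := by rw [hsq]; ring
    _ = _ := by rw [hF, sin_sq]; ring

/-- (i) `(d/dv)‖c(v)‖² = 2(‖p‖ + R) sin(v/R)`, and `v ↦ ‖c(v)‖` is strictly increasing on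
`[0, πR]`; (ii) `‖c(0)‖ = ‖p‖ < 1` and `‖c(πR)‖ = 1/‖p‖ > 1`; (iii) there exists a unique
`v_p ∈ (0, πR)` with `‖c(v_p)‖ = 1`, and `‖c(v)‖ < 1` for `|v| < v_p` while
`‖c(±v_p)‖ = 1` (using `‖c(-v)‖ = ‖c(v)‖`). -/
theorem circle_boundary_parameter (p : ℝ × ℝ) (hp0 : 0 < norm2 p) (hp1 : norm2 p < 1)
    (R : ℝ) (hR : R = (1 / norm2 p - norm2 p) / 2)
    (F : ℝ → ℝ) (hF : ∀ v, F v = 1 + (R / norm2 p) * (1 - Real.cos (v / R)))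
    (c : ℝ → ℝ × ℝ × ℝ)
    (hc : ∀ v, c v = (F v * p.1, F v * p.2, R * Real.sin (v / R))) :
    ((∀ v : ℝ, deriv (fun w => norm3 (c w) ^ 2) v = 2 * (norm2 p + R) * Real.sin (v / R)) ∧
      StrictMonoOn (fun v => norm3 (c v)) (Set.Icc 0 (π * R))) ∧
    (norm3 (c 0) = norm2 p ∧ norm2 p < 1 ∧
      norm3 (c (π * R)) = 1 / norm2 p ∧ 1 < 1 / norm2 p) ∧
    ((∀ v : ℝ, norm3 (c (-v)) = norm3 (c v)) ∧
      ∃ vp ∈ Set.Ioo 0 (π * R), norm3 (c vp) = 1 ∧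
        (∀ w ∈ Set.Ioo 0 (π * R), norm3 (c w) = 1 → w = vp) ∧
        (∀ v : ℝ, |v| < vp → norm3 (c v) < 1) ∧
        norm3 (c vp) = 1 ∧ norm3 (c (-vp)) = 1) := by
  set r := norm2 p with hr
  have hinv : 1 < 1 / r := by rwa [lt_div_iff₀ hp0, one_mul]
  have hRpos : 0 < R := by rw [hR]; linarith
  have hsq (v : ℝ) : (c v).1 ^ 2 + (c v).2.1 ^ 2 + (c v).2.2 ^ 2 =
      r ^ 2 + 2 * R * (r + R) * (1 - cos (v / R)) := by
    rw [hc, hF]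
    exact circle_normSq p hp0 R (v / R)
  have hnorm (v : ℝ) :
      norm3 (c v) = √(r ^ 2 + 2 * R * (r + R) * (1 - cos (v / R))) := by
    rw [norm3, hsq]
  have hK : 0 < 2 * R * (r + R) := by positivity
  have hnonneg (v : ℝ) : 0 ≤ r ^ 2 + 2 * R * (r + R) * (1 - cos (v / R)) := by
    have := sub_nonneg.2 (cos_le_one (v / R))
    positivity
  have hderiv (v : ℝ) :
      deriv (fun w => norm3 (c w) ^ 2) v = 2 * (r + R) * sin (v / R) := by
    simp only [hnorm, sq_sqrt (hnonneg _)]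
    have h := ((((hasDerivAt_id v).div_const R).cos.const_sub 1).const_mul
      (2 * R * (r + R))).const_add (r ^ 2)
    refine h.deriv.trans ?_
    simp only [id]
    field_simp
  have hmono : StrictMonoOn (fun v => norm3 (c v)) (Set.Icc 0 (π * R)) := by
    have hmaps {v : ℝ} (hv : v ∈ Set.Icc 0 (π * R)) : v / R ∈ Set.Icc 0 π :=
      ⟨div_nonneg hv.1 hRpos.le, (div_le_iff₀ hRpos).2 hv.2⟩
    intro v hv w hw hvw
    simp only [hnorm]
    refine sqrt_lt_sqrt (hnonneg v) ?_
    have hcos := strictAntiOn_cos (hmaps hv) (hmaps hw) (div_lt_div_of_pos_right hvw hRpos)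
    gcongr
  have hzero : norm3 (c 0) = r := by
    rw [hnorm]
    simp [sqrt_sq hp0.le]
  have hend : norm3 (c (π * R)) = 1 / r := by
    rw [hnorm, mul_div_cancel_right₀ _ hRpos.ne', cos_pi,
      show r ^ 2 + 2 * R * (r + R) * (1 - -1) = (r + 2 * R) ^ 2 by ring,
      sqrt_sq (by positivity), hR]
    ring
  have heven (v : ℝ) : norm3 (c (-v)) = norm3 (c v) := by
    rw [hnorm, hnorm, neg_div, cos_neg]
  have hcont : Continuous fun v => norm3 (c v) := by
    simp only [hnorm]
    fun_prop
  obtain ⟨vp, hvp, hone⟩ : (1 : ℝ) ∈ (fun v => norm3 (c v)) '' Set.Ioo 0 (π * R) :=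
    intermediate_value_Ioo (by positivity) hcont.continuousOn
      ⟨by simpa only [hzero] using hp1, by simpa only [hend] using hinv⟩
  have hone : norm3 (c vp) = 1 := hone
  have hvp' := Set.Ioo_subset_Icc_self hvp
  refine ⟨⟨hderiv, hmono⟩, ⟨hzero, hp1, hend, hinv⟩, heven, vp, hvp, hone,
    fun w hw hw1 => hmono.injOn (Set.Ioo_subset_Icc_self hw) hvp' (hw1.trans hone.symm),
    fun v hv => ?_, hone, (heven vp).trans hone⟩
  have habs : norm3 (c |v|) = norm3 (c v) := by
    rcases abs_choice v with h | h <;> simp only [h, heven]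
  rw [← habs, ← hone]
  exact hmono ⟨abs_nonneg v, hv.le.trans hvp'.2⟩ hvp' hv
end
end

section
/- Let γ be a ribbon and let ψ be the associated parametrized surface. Then for every (u,v) with γ(u) ≠ (0,0) and ‖ψ(u,v)‖ = 1, one has ⟨ψ(u,v), ψ_u(u,v) × ψ_v(u,v)⟩ = 0. (At every point where the surface touches the unit sphere, the position vector is tangent to the surface; this is the free boundary condition.) -/
open Real Set

noncomputable section

/-- `r(u) = ‖γ(u)‖`. -/
def rad (Rb : Ribbon) (u : ℝ) : ℝ := norm2 (Rb.γ u)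

/-- `R(u) = (1/r(u) - r(u))/2`, the radius of the vertical circle through `γ(u)` meeting the
horizontal unit disk and the unit sphere orthogonally. -/
def Rrad (Rb : Ribbon) (u : ℝ) : ℝ := (1 / rad Rb u - rad Rb u) / 2

/-- `F(u,v) = 1 + (R(u)/r(u))(1 - cos(v/R(u)))`. -/
def Ffun (Rb : Ribbon) (u v : ℝ) : ℝ :=
  1 + (Rrad Rb u / rad Rb u) * (1 - Real.cos (v / Rrad Rb u))

/-- The surface `ψ(u,v) = (γ₁(u)F(u,v), γ₂(u)F(u,v), R(u)sin(v/R(u)))` associated to a ribbon. -/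
def ψ (Rb : Ribbon) (u v : ℝ) : ℝ × ℝ × ℝ :=
  ((Rb.γ u).1 * Ffun Rb u v, (Rb.γ u).2 * Ffun Rb u v,
    Rrad Rb u * Real.sin (v / Rrad Rb u))

/-- Partial derivative `ψ_u`. -/
def ψu (Rb : Ribbon) (u v : ℝ) : ℝ × ℝ × ℝ := deriv (fun s => ψ Rb s v) u

/-- Partial derivative `ψ_v`. -/
def ψv (Rb : Ribbon) (u v : ℝ) : ℝ × ℝ × ℝ := deriv (fun w => ψ Rb u w) v

/-- Second partial derivative `ψ_vv`. -/
def ψvv (Rb : Ribbon) (u v : ℝ) : ℝ × ℝ × ℝ := deriv (fun w => ψv Rb u w) v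

theorem rad_sq (Rb : Ribbon) (u : ℝ) : rad Rb u ^ 2 = (Rb.γ u).1 ^ 2 + (Rb.γ u).2 ^ 2 :=
  Real.sq_sqrt (by positivity)

theorem rad_pos (Rb : Ribbon) {u : ℝ} (h : Rb.γ u ≠ (0, 0)) : 0 < rad Rb u := by
  refine Real.sqrt_pos.2 ((by positivity : 0 ≤ (Rb.γ u).1 ^ 2 + (Rb.γ u).2 ^ 2).lt_of_ne' ?_)
  intro h0
  exact h (Prod.ext (by dsimp only; nlinarith [sq_nonneg (Rb.γ u).1, sq_nonneg (Rb.γ u).2])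
    (by dsimp only; nlinarith [sq_nonneg (Rb.γ u).1, sq_nonneg (Rb.γ u).2]))

theorem ψv_of_Rrad_eq_zero (Rb : Ribbon) {u : ℝ} (hR : Rrad Rb u = 0) (v : ℝ) :
    ψv Rb u v = 0 := by
  simp [ψv, ψ, Ffun, hR]

theorem ψv_of_Rrad_ne_zero (Rb : Ribbon) {u : ℝ} (hR : Rrad Rb u ≠ 0) (v : ℝ) :
    ψv Rb u v =
      ((Rb.γ u).1 * (Real.sin (v / Rrad Rb u) / rad Rb u),
        (Rb.γ u).2 * (Real.sin (v / Rrad Rb u) / rad Rb u), Real.cos (v / Rrad Rb u)) := by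
  have hθ : HasDerivAt (fun w => w / Rrad Rb u) (1 / Rrad Rb u) v :=
    (hasDerivAt_id v).div_const _
  have hF : HasDerivAt (fun w => Ffun Rb u w) (Real.sin (v / Rrad Rb u) / rad Rb u) v := by
    refine (((hθ.cos.const_sub 1).const_mul (Rrad Rb u / rad Rb u)).const_add 1).congr_deriv ?_
    field_simp
  have hz : HasDerivAt (fun w => Rrad Rb u * Real.sin (w / Rrad Rb u))
      (Real.cos (v / Rrad Rb u)) v := by
    refine (hθ.sin.const_mul (Rrad Rb u)).congr_deriv ?_
    field_simp
  exact ((hF.const_mul _).prodMk ((hF.const_mul _).prodMk hz)).deriv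

/-- Where a non-degenerate vertical circle meets the unit sphere, the position vector is
parallel to `ψ_v`. -/
theorem Ffun_mul_cos_eq (Rb : Ribbon) {u v : ℝ} (hr : 0 < rad Rb u) (hR : Rrad Rb u ≠ 0)
    (h : norm3 (ψ Rb u v) = 1) :
    Ffun Rb u v * Real.cos (v / Rrad Rb u) =
      Rrad Rb u * Real.sin (v / Rrad Rb u) ^ 2 / rad Rb u := by
  have hsq : ((Rb.γ u).1 * Ffun Rb u v) ^ 2 + ((Rb.γ u).2 * Ffun Rb u v) ^ 2 +
      (Rrad Rb u * Real.sin (v / Rrad Rb u)) ^ 2 = 1 := Real.sqrt_eq_one.1 h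
  have hr2 := rad_sq Rb u
  have hrF : rad Rb u * Ffun Rb u v =
      rad Rb u + Rrad Rb u * (1 - Real.cos (v / Rrad Rb u)) := by
    unfold Ffun
    field_simp
  have hdef : 2 * Rrad Rb u * rad Rb u = 1 - rad Rb u ^ 2 := by
    unfold Rrad
    field_simp
  have hsc := Real.sin_sq_add_cos_sq (v / Rrad Rb u)
  generalize Real.sin (v / Rrad Rb u) = s at *
  generalize Real.cos (v / Rrad Rb u) = c at *
  generalize Ffun Rb u v = F at *
  generalize rad Rb u = r at *
  generalize Rrad Rb u = R at *
  have hnorm : (r + R * (1 - c)) ^ 2 + (R * s) ^ 2 = 1 := by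
    rw [← hrF]
    linear_combination hsq + F ^ 2 * hr2
  have hc : (r + R) * c = R := by
    apply mul_left_cancel₀ (mul_ne_zero two_ne_zero hR)
    linear_combination -hnorm + R ^ 2 * hsc + hdef
  rw [eq_div_iff hr.ne']
  linear_combination c * hrF + hc - R * hsc

/-- **Free boundary condition (Proposition 2.8).** For a ribbon `γ` and the associated surface
`ψ`, at every point where the surface touches the unit sphere the position vector is tangent
to the surface. -/
theorem ribbon_surface_free_boundary (Rb : Ribbon) :
    ∀ u ∈ Set.Icc (-Rb.u₃) Rb.u₃, ∀ v : ℝ,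
      Rb.γ u ≠ (0, 0) → norm3 (ψ Rb u v) = 1 →
      dot3 (ψ Rb u v) (cross3 (ψu Rb u v) (ψv Rb u v)) = 0 := by
  intro u _ v hγ hnorm
  by_cases hR : Rrad Rb u = 0
  · simp [ψv_of_Rrad_eq_zero Rb hR, dot3, cross3]
  · have hpar := Ffun_mul_cos_eq Rb (rad_pos Rb hγ) hR hnorm
    rw [ψv_of_Rrad_ne_zero Rb hR]
    simp only [dot3, cross3, ψ]
    linear_combination
      ((Rb.γ u).1 * (ψu Rb u v).2.1 - (Rb.γ u).2 * (ψu Rb u v).1) * hpar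
end
end

section
/- Let 0 < u₁ < u₂ and let γ = (γ₁,γ₂) : [u₁, u₂] → ℝ² be a C² curve parametrized by arc length, with unit normal n(u) = (−γ₂'(u), γ₁'(u)) and curvature κ(u) = ⟨γ''(u), n(u)⟩. Assume that γ(u₂) = (0, a) for some a ∈ (0,1), γ'(u₂) = (0,−1) (so n(u₂) = (1,0)), and that κ is nonnegative and monotonically decreasing on [u₁, u₂]. Then there exists a constant C > 0 such that |⟨n(u), γ(u)⟩| ≤ C·κ(u) for every u ∈ [u₁, u₂]. -/
open Real Set

noncomputable section

/-- The constancy of the speed makes the acceleration orthogonal to the velocity, so that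
`u ↦ ⟨n, γ⟩` has derivative `-κ ⟨γ', γ⟩` wherever the curve has unit speed nearby. -/
theorem hasDerivAt_normal_dot_position {γ : ℝ → ℝ × ℝ} (hγ : ContDiff ℝ 2 γ) {u : ℝ}
    (hunit : ∀ᶠ v in nhds u, norm2 (deriv γ v) = 1) :
    HasDerivAt (fun v => dot2 (-(deriv γ v).2, (deriv γ v).1) (γ v))
      (-(dot2 (deriv (deriv γ) u) (-(deriv γ u).2, (deriv γ u).1) * dot2 (deriv γ u) (γ u))) u := by
  have hγ' : HasDerivAt γ (deriv γ u) u :=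
    (hγ.differentiable (by norm_num) u).hasDerivAt
  have hγ'' : HasDerivAt (deriv γ) (deriv (deriv γ) u) u :=
    ((ContDiff.iterate_deriv' 1 1 hγ).differentiable (by norm_num) u).hasDerivAt
  have hsq : ∀ᶠ v in nhds u, (deriv γ v).1 ^ 2 + (deriv γ v).2 ^ 2 = 1 := by
    filter_upwards [hunit] with v hv
    exact Real.sqrt_eq_one.mp hv
  have hp : HasDerivAt (fun v => (deriv γ v).1) (deriv (deriv γ) u).1 u :=
    (ContinuousLinearMap.fst ℝ ℝ ℝ).hasFDerivAt.comp_hasDerivAt u hγ''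
  have hq : HasDerivAt (fun v => (deriv γ v).2) (deriv (deriv γ) u).2 u :=
    (ContinuousLinearMap.snd ℝ ℝ ℝ).hasFDerivAt.comp_hasDerivAt u hγ''
  have hx : HasDerivAt (fun v => (γ v).1) (deriv γ u).1 u :=
    (ContinuousLinearMap.fst ℝ ℝ ℝ).hasFDerivAt.comp_hasDerivAt u hγ'
  have hy : HasDerivAt (fun v => (γ v).2) (deriv γ u).2 u :=
    (ContinuousLinearMap.snd ℝ ℝ ℝ).hasFDerivAt.comp_hasDerivAt u hγ'
  have horth := ((hp.pow 2).add (hq.pow 2)).unique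
    ((hasDerivAt_const u (1 : ℝ)).congr_of_eventuallyEq hsq)
  have hu := hsq.self_of_nhds
  refine ((hq.neg.mul hx).add (hp.mul hy)).congr_deriv ?_
  simp only [dot2, Pi.neg_apply]
  norm_num at horth
  generalize (deriv γ u).1 = p at *
  generalize (deriv γ u).2 = q at *
  generalize (deriv (deriv γ) u).1 = p' at *
  generalize (deriv (deriv γ) u).2 = q' at *
  linear_combination (q' * (γ u).1 - p' * (γ u).2) * hu
    + (p * (γ u).2 - q * (γ u).1) / 2 * horth

/-- Bound on the radial component of the normal: for a unit-speed `C²` planar curve on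
`[u₁, u₂]` ending at `γ(u₂) = (0,a)` with `γ'(u₂) = (0,-1)`, whose curvature `κ` is
nonnegative and monotonically decreasing on `[u₁,u₂]`, there is `C > 0` with
`|⟨n(u), γ(u)⟩| ≤ C·κ(u)` on `[u₁, u₂]`. -/
theorem normal_radial_component_bound (u₁ u₂ a : ℝ) (hu₁ : 0 < u₁) (h₁₂ : u₁ < u₂)
    (ha : a ∈ Set.Ioo (0 : ℝ) 1)
    (γ : ℝ → ℝ × ℝ) (hγ : ContDiff ℝ 2 γ)
    (harc : ∀ u ∈ Set.Icc u₁ u₂, norm2 (deriv γ u) = 1)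
    (n : ℝ → ℝ × ℝ) (hn : ∀ u, n u = (-(deriv γ u).2, (deriv γ u).1))
    (κ : ℝ → ℝ) (hκ : ∀ u, κ u = dot2 (deriv (deriv γ) u) (n u))
    (hend : γ u₂ = (0, a)) (hend' : deriv γ u₂ = (0, -1))
    (hκnonneg : ∀ u ∈ Set.Icc u₁ u₂, 0 ≤ κ u)
    (hκdec : AntitoneOn κ (Set.Icc u₁ u₂)) :
    ∃ C > 0, ∀ u ∈ Set.Icc u₁ u₂, |dot2 (n u) (γ u)| ≤ C * κ u := by
  obtain rfl : n = fun u => (-(deriv γ u).2, (deriv γ u).1) := funext hn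
  have hcont : Continuous (deriv γ) := hγ.continuous_deriv (by norm_num)
  have hcontγ : Continuous γ := hγ.continuous
  obtain ⟨M, hM⟩ := isCompact_Icc.exists_bound_of_continuousOn (s := Icc u₁ u₂)
    (f := fun u => dot2 (deriv γ u) (γ u)) (by unfold dot2; fun_prop)
  have hM₀ : 0 ≤ M := (norm_nonneg _).trans (hM u₁ ⟨le_rfl, h₁₂.le⟩)
  refine ⟨M * (u₂ - u₁) + 1, by nlinarith, fun u hu => ?_⟩
  have hκu := hκnonneg u hu
  have hzero : dot2 (-(deriv γ u₂).2, (deriv γ u₂).1) (γ u₂) = 0 := by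
    simp [dot2, hend, hend']
  rcases hu.2.eq_or_lt with rfl | hlt
  · simp only [hzero, abs_zero]
    exact mul_nonneg (by nlinarith) hκu
  have hderiv : ∀ v ∈ Ioo u u₂, HasDerivAt _ _ v := fun v hv =>
    hasDerivAt_normal_dot_position hγ <| by
      filter_upwards [Ioo_mem_nhds (hu.1.trans_lt hv.1) hv.2] with w hw
      exact harc w (Ioo_subset_Icc_self hw)
  obtain ⟨c, hc, hslope⟩ := exists_hasDerivAt_eq_slope _ _ hlt
    (by unfold dot2; fun_prop) hderiv
  have hcI : c ∈ Icc u₁ u₂ := ⟨hu.1.trans hc.1.le, hc.2.le⟩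
  rw [← hκ c, hzero, eq_div_iff (sub_pos.mpr hlt).ne', zero_sub, neg_mul, neg_inj] at hslope
  have hbound : |dot2 (deriv γ c) (γ c)| ≤ M := hM c hcI
  have hκc := hκnonneg c hcI
  calc |dot2 (-(deriv γ u).2, (deriv γ u).1) (γ u)|
      = κ c * |dot2 (deriv γ c) (γ c)| * (u₂ - u) := by
        rw [← hslope, abs_mul, abs_mul, abs_of_nonneg hκc, abs_of_pos (sub_pos.mpr hlt)]
    _ ≤ κ u * M * (u₂ - u₁) := by
        gcongr
        · exact hκdec hu hcI hc.1.le
        · exact hu.1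
    _ ≤ (M * (u₂ - u₁) + 1) * κ u := by linarith
end
end

section
/- Let 0 < r₀ ≤ r₁ < 1. For r ∈ [r₀, r₁], c ∈ [−1,1] and t ∈ (0,1], set R(t,r) = (1/(tr) − tr)/2 and, whenever R(t,r) ≥ 1, set G(t,r,c) = R(t,r)·(1 − √(1 − (c/R(t,r))²)). Then there exist t* ∈ (0,1] and C > 0 such that R(t,r) ≥ 1 and |G(t,r,c) − c²·r·t| ≤ C·t³ for all t ∈ (0, t*], r ∈ [r₀, r₁] and c ∈ [−1,1]. -/
open Real Set

noncomputable section

/-- `R(t,r) = (1/(tr) - tr)/2`. -/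
def Rtr (t r : ℝ) : ℝ := (1 / (t * r) - t * r) / 2

/-- `G(t,r,c) = R(t,r)·(1 - √(1 - (c/R(t,r))²))`. -/
def Gtrc (t r c : ℝ) : ℝ := Rtr t r * (1 - Real.sqrt (1 - (c / Rtr t r) ^ 2))

/-- The error of the quadratic Taylor polynomial of `1 - √(1 - x²)` at `0`. -/
lemma abs_one_sub_sqrt_one_sub_sq_sub_le {x : ℝ} (hx : x ^ 2 ≤ 1) :
    |1 - √(1 - x ^ 2) - x ^ 2 / 2| ≤ x ^ 4 / 2 := by
  have hy0 : 0 ≤ √(1 - x ^ 2) := Real.sqrt_nonneg _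
  have hy : √(1 - x ^ 2) ^ 2 = 1 - x ^ 2 := Real.sq_sqrt (by linarith)
  generalize √(1 - x ^ 2) = y at hy0 hy
  have hx2 : x ^ 2 = (1 - y) * (1 + y) := by linarith
  have hy1 : y ≤ 1 := by nlinarith [sq_nonneg x]
  have hx4 : x ^ 4 = (1 - y) ^ 2 * (1 + y) ^ 2 := by
    rw [← mul_pow, ← hx2]; ring
  rw [hx2, hx4, abs_le]
  constructor
  · nlinarith [mul_nonneg (sq_nonneg (1 - y)) (sq_nonneg (1 + y)), sq_nonneg (1 - y)]
  · nlinarith [mul_nonneg (sq_nonneg (1 - y)) (by nlinarith : 0 ≤ (1 + y) ^ 2 - 1)]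

lemma Rtr_eq_div {t r : ℝ} (h : t * r ≠ 0) :
    Rtr t r = (1 - (t * r) ^ 2) / (2 * (t * r)) := by
  unfold Rtr
  generalize t * r = s at h
  field_simp

/-- A cubic bound for `G(t,r,c) - c²rt` in terms of `tr`. -/
lemma abs_Gtrc_sub_le {t r c : ℝ} (hs : 0 < t * r) (hs' : t * r ≤ 1 / 4) (hc : c ^ 2 ≤ 1) :
    1 ≤ Rtr t r ∧ |Gtrc t r c - c ^ 2 * r * t| ≤ 16 * (t * r) ^ 3 := by
  have hR := Rtr_eq_div hs.ne'
  have hG : Gtrc t r c = Rtr t r * (1 - √(1 - (c / Rtr t r) ^ 2)) := rfl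
  rw [show c ^ 2 * r * t = c ^ 2 * (t * r) by ring, hG]
  generalize Rtr t r = R at hR
  generalize t * r = s at *
  have hd : 0 < 1 - s ^ 2 := by nlinarith
  have hR1 : 1 ≤ R := by
    rw [hR, le_div_iff₀ (by positivity)]; nlinarith
  refine ⟨hR1, ?_⟩
  have hR0 : 0 < R := by linarith
  have hu : 1 / R ≤ 3 * s := by
    rw [hR, one_div_div, div_le_iff₀ hd]; nlinarith
  have hx : (c / R) ^ 2 ≤ 1 := by
    rw [div_pow, div_le_one (by positivity)]; nlinarith
  have hmain : |R * (1 - √(1 - (c / R) ^ 2) - (c / R) ^ 2 / 2)| ≤ 27 / 2 * s ^ 3 := by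
    rw [abs_mul, abs_of_pos hR0]
    calc R * |1 - √(1 - (c / R) ^ 2) - (c / R) ^ 2 / 2|
        ≤ R * ((c / R) ^ 4 / 2) :=
          mul_le_mul_of_nonneg_left (abs_one_sub_sqrt_one_sub_sq_sub_le hx) hR0.le
      _ = (c ^ 2) ^ 2 * (1 / R) ^ 3 / 2 := by field_simp
      _ ≤ 1 ^ 2 * (3 * s) ^ 3 / 2 := by gcongr
      _ = 27 / 2 * s ^ 3 := by ring
  have hlin : R * ((c / R) ^ 2 / 2) - c ^ 2 * s = c ^ 2 * (s ^ 3 / (1 - s ^ 2)) := by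
    rw [hR]
    field_simp
    ring
  have hfrac : s ^ 3 / (1 - s ^ 2) ≤ 2 * s ^ 3 := by
    rw [div_le_iff₀ hd]
    nlinarith [mul_nonneg (pow_pos hs 3).le (by nlinarith : 0 ≤ 2 * (1 - s ^ 2) - 1)]
  have hfrac0 : 0 ≤ s ^ 3 / (1 - s ^ 2) := by positivity
  have hrest : |R * ((c / R) ^ 2 / 2) - c ^ 2 * s| ≤ 2 * s ^ 3 := by
    rw [hlin, abs_of_nonneg (by positivity)]
    nlinarith
  calc |R * (1 - √(1 - (c / R) ^ 2)) - c ^ 2 * s|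
      = |R * (1 - √(1 - (c / R) ^ 2) - (c / R) ^ 2 / 2)
          + (R * ((c / R) ^ 2 / 2) - c ^ 2 * s)| := by congr 1; ring
    _ ≤ 27 / 2 * s ^ 3 + 2 * s ^ 3 := (abs_add_le _ _).trans (add_le_add hmain hrest)
    _ ≤ 16 * s ^ 3 := by nlinarith [pow_pos hs 3]

/-- Uniform expansion `G(t,r,c) = c²rt + O(t³)`: there exist `t* ∈ (0,1]` and `C > 0` such
that `R(t,r) ≥ 1` and `|G(t,r,c) - c²rt| ≤ C·t³` for all `t ∈ (0,t*]`, `r ∈ [r₀,r₁]`,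
`c ∈ [-1,1]`. -/
theorem G_expansion (r₀ r₁ : ℝ) (hr₀ : 0 < r₀) (hr : r₀ ≤ r₁) (hr₁ : r₁ < 1) :
    ∃ tstar ∈ Set.Ioc (0 : ℝ) 1, ∃ C > 0,
      ∀ t ∈ Set.Ioc (0 : ℝ) tstar, ∀ r ∈ Set.Icc r₀ r₁, ∀ c ∈ Set.Icc (-1 : ℝ) 1,
        1 ≤ Rtr t r ∧ |Gtrc t r c - c ^ 2 * r * t| ≤ C * t ^ 3 := by
  refine ⟨1 / 4, by norm_num, 16, by norm_num, ?_⟩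
  rintro t ⟨ht0, ht⟩ r ⟨hr0, hr1⟩ c ⟨hc0, hc1⟩
  have hrpos : 0 < r := by linarith
  have hts : t * r ≤ t := by nlinarith
  obtain ⟨hR, hG⟩ := abs_Gtrc_sub_le (c := c) (mul_pos ht0 hrpos) (hts.trans ht) (by nlinarith)
  refine ⟨hR, hG.trans ?_⟩
  gcongr
end
end

section
/- Let γ be a ribbon. For t ∈ (0,1] and c ∈ [−1,1], set R_t(u) = (1/(t‖γ(u)‖) − t‖γ(u)‖)/2 and, whenever R_t(u) ≥ 1, set G_t(u) = R_t(u)·(1 − √(1 − (c/R_t(u))²)), and define the planar curve Γ_{t,c}(u) = t·γ(u)·(1 + G_t(u)/(t‖γ(u)‖)) for u ∈ [−u₂, u₂]. Then there exists t₀ ∈ (0,1] such that for every t ∈ (0, t₀] and every c ∈ [−1,1]: R_t(u) ≥ 1 for all u ∈ [−u₂,u₂], the curve Γ_{t,c} is regular, and det(Γ_{t,c}'(u), Γ_{t,c}''(u)) > 0 for every u ∈ (−u₂, u₂) (i.e. the horizontal level curves of the scaled surface are strictly convex). -/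
open Real Set

noncomputable section

/-- `R_t(u) = (1/(t‖γ(u)‖) - t‖γ(u)‖)/2`. -/
def Rt (Rb : Ribbon) (t u : ℝ) : ℝ :=
  (1 / (t * norm2 (Rb.γ u)) - t * norm2 (Rb.γ u)) / 2

/-- `G_t(u) = R_t(u)·(1 - √(1 - (c/R_t(u))²))`. -/
def Gt (Rb : Ribbon) (t c u : ℝ) : ℝ :=
  Rt Rb t u * (1 - Real.sqrt (1 - (c / Rt Rb t u) ^ 2))

/-- The horizontal level curve `Γ_{t,c}(u) = t·γ(u)·(1 + G_t(u)/(t‖γ(u)‖))`. -/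
def Γcurve (Rb : Ribbon) (t c u : ℝ) : ℝ × ℝ :=
  ((t * (Rb.γ u).1) * (1 + Gt Rb t c u / (t * norm2 (Rb.γ u))),
   (t * (Rb.γ u).2) * (1 + Gt Rb t c u / (t * norm2 (Rb.γ u))))

/-- The discriminant root `√((1 - q)² - 4c²q)`, where `q` stands for `(t‖γ‖)²`. -/
def levelRoot (c q : ℝ) : ℝ := √((1 - q) ^ 2 - 4 * c ^ 2 * q)

/-- The quotient `G_t / (t‖γ‖)` as a function of `c` and `q = (t‖γ‖)²`. -/
def levelGrowth (c q : ℝ) : ℝ := 2 * c ^ 2 / (1 - q + levelRoot c q)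

/-- The `q`-derivative of `levelGrowth`. -/
def levelGrowthDeriv (c q : ℝ) : ℝ :=
  levelGrowth c q * (1 + levelGrowth c q) / levelRoot c q

/-- The second `q`-derivative of `levelGrowth`. -/
def levelGrowthDeriv₂ (c q : ℝ) : ℝ :=
  ((levelGrowthDeriv c q * (1 + levelGrowth c q) + levelGrowth c q * levelGrowthDeriv c q) *
    levelRoot c q - levelGrowth c q * (1 + levelGrowth c q) *
    (-(1 - q + 2 * c ^ 2) / levelRoot c q)) / levelRoot c q ^ 2

section LevelGrowth

variable {c q : ℝ}

lemma quarter_le_discr (hc : c ^ 2 ≤ 1) (hq : q ∈ Ioo (0 : ℝ) (1 / 100)) :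
    1 / 4 ≤ (1 - q) ^ 2 - 4 * c ^ 2 * q := by
  obtain ⟨h0, h1⟩ := hq
  nlinarith [mul_le_mul_of_nonneg_right hc h0.le]

lemma half_le_levelRoot (hc : c ^ 2 ≤ 1) (hq : q ∈ Ioo (0 : ℝ) (1 / 100)) :
    1 / 2 ≤ levelRoot c q := by
  apply Real.le_sqrt_of_sq_le
  linarith [quarter_le_discr hc hq]

lemma one_le_denominator (hc : c ^ 2 ≤ 1) (hq : q ∈ Ioo (0 : ℝ) (1 / 100)) :
    1 ≤ 1 - q + levelRoot c q := by
  linarith [half_le_levelRoot hc hq, hq.2]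

lemma levelGrowth_mem_Icc (hc : c ^ 2 ≤ 1) (hq : q ∈ Ioo (0 : ℝ) (1 / 100)) :
    levelGrowth c q ∈ Icc (0 : ℝ) 2 := by
  have hT := one_le_denominator hc hq
  refine ⟨by unfold levelGrowth; positivity, ?_⟩
  rw [levelGrowth, div_le_iff₀ (by linarith)]
  linarith

lemma levelGrowthDeriv_mem_Icc (hc : c ^ 2 ≤ 1) (hq : q ∈ Ioo (0 : ℝ) (1 / 100)) :
    levelGrowthDeriv c q ∈ Icc (0 : ℝ) 12 := by
  have hS := half_le_levelRoot hc hq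
  obtain ⟨h0, h2⟩ := levelGrowth_mem_Icc hc hq
  refine ⟨by unfold levelGrowthDeriv; positivity, ?_⟩
  rw [levelGrowthDeriv, div_le_iff₀ (by linarith)]
  nlinarith

lemma abs_levelGrowthDeriv₂_le (hc : c ^ 2 ≤ 1) (hq : q ∈ Ioo (0 : ℝ) (1 / 100)) :
    |levelGrowthDeriv₂ c q| ≤ 300 := by
  have hS := half_le_levelRoot hc hq
  obtain ⟨h0, h2⟩ := levelGrowth_mem_Icc hc hq
  obtain ⟨k0, k2⟩ := levelGrowthDeriv_mem_Icc hc hq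
  obtain ⟨hq0, hq1⟩ := hq
  have hS0 : levelRoot c q ≠ 0 := by linarith
  have hi0 : 0 ≤ (levelRoot c q)⁻¹ := by positivity
  have hi : (levelRoot c q)⁻¹ ≤ 2 := by
    rw [inv_le_comm₀ (by linarith) (by norm_num)]; linarith
  have key : levelGrowthDeriv₂ c q =
      levelGrowthDeriv c q * (1 + 2 * levelGrowth c q) * (levelRoot c q)⁻¹ +
      levelGrowth c q * (1 + levelGrowth c q) * (1 - q + 2 * c ^ 2) * (levelRoot c q)⁻¹ ^ 3 := by
    unfold levelGrowthDeriv₂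
    field_simp
    ring
  have hc0 : 0 ≤ 1 - q + 2 * c ^ 2 := by nlinarith [sq_nonneg c]
  rw [key, abs_of_nonneg (by positivity)]
  refine le_trans (b := 12 * (1 + 2 * 2) * 2 + 2 * (1 + 2) * (1 + 2 * 1) * 2 ^ 3) ?_ (by norm_num)
  gcongr
  exact sub_le_self 1 hq0.le

lemma hasDerivAt_levelRoot (hc : c ^ 2 ≤ 1) (hq : q ∈ Ioo (0 : ℝ) (1 / 100)) :
    HasDerivAt (levelRoot c) (-(1 - q + 2 * c ^ 2) / levelRoot c q) q := by
  have hd := quarter_le_discr hc hq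
  have h1 : HasDerivAt (fun q : ℝ => (1 - q) ^ 2 - 4 * c ^ 2 * q)
      (2 * (1 - q) * (-1) - 4 * c ^ 2) q := by
    have := (((hasDerivAt_id q).const_sub 1).pow 2).sub ((hasDerivAt_id q).const_mul (4 * c ^ 2))
    exact this.congr_deriv (by simp)
  have hS := half_le_levelRoot hc hq
  refine (h1.sqrt (by linarith)).congr_deriv ?_
  change _ / (2 * levelRoot c q) = _
  field_simp
  ring

lemma hasDerivAt_levelGrowth (hc : c ^ 2 ≤ 1) (hq : q ∈ Ioo (0 : ℝ) (1 / 100)) :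
    HasDerivAt (levelGrowth c) (levelGrowthDeriv c q) q := by
  have hS := half_le_levelRoot hc hq
  have hT := one_le_denominator hc hq
  have hT0 : 1 - q + levelRoot c q ≠ 0 := by linarith
  have hS0 : levelRoot c q ≠ 0 := by linarith
  have h := (hasDerivAt_const q (2 * c ^ 2)).div
    (((hasDerivAt_id q).const_sub 1).add (hasDerivAt_levelRoot hc hq)) hT0
  refine h.congr_deriv ?_
  simp only [levelGrowthDeriv, levelGrowth, id, Pi.add_apply]
  field_simp
  ring

lemma hasDerivAt_levelGrowthDeriv (hc : c ^ 2 ≤ 1) (hq : q ∈ Ioo (0 : ℝ) (1 / 100)) :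
    HasDerivAt (levelGrowthDeriv c) (levelGrowthDeriv₂ c q) q := by
  have hS := half_le_levelRoot hc hq
  have hX := hasDerivAt_levelGrowth hc hq
  exact (hX.mul (hX.const_add 1)).div (hasDerivAt_levelRoot hc hq) (by linarith)

end LevelGrowth

lemma hasDerivAt_deriv_of_contDiff {f : ℝ → ℝ} (hf : ContDiff ℝ (⊤ : ℕ∞) f) (u : ℝ) :
    HasDerivAt f (deriv f u) u ∧ HasDerivAt (deriv f) (deriv (deriv f) u) u := by
  have hf' : ContDiff ℝ (⊤ : ℕ∞) (deriv f) := hf.iterate_deriv 1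
  exact ⟨((hf.differentiable (by simp)) u).hasDerivAt,
    ((hf'.differentiable (by simp)) u).hasDerivAt⟩

/-- `G_t / (t‖γ‖)` depends only on `c` and `(t‖γ‖)²`. -/
lemma Gt_div_eq_levelGrowth {Rb : Ribbon} {t c u : ℝ} (hc : c ^ 2 ≤ 1)
    (hs : 0 < t * norm2 (Rb.γ u))
    (hq : (t * norm2 (Rb.γ u)) ^ 2 ∈ Ioo (0 : ℝ) (1 / 100)) :
    Gt Rb t c u / (t * norm2 (Rb.γ u)) = levelGrowth c ((t * norm2 (Rb.γ u)) ^ 2) := by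
  unfold Gt Rt
  set s := t * norm2 (Rb.γ u)
  have hA : 0 < 1 - s ^ 2 := by linarith [hq.2]
  have hd := quarter_le_discr hc hq
  have hT := one_le_denominator hc hq
  have hsq : levelRoot c (s ^ 2) ^ 2 = (1 - s ^ 2) ^ 2 - 4 * c ^ 2 * s ^ 2 :=
    Real.sq_sqrt (by linarith)
  have hR : (1 / s - s) / 2 = (1 - s ^ 2) / (2 * s) := by field_simp
  have hroot : √(1 - (c / ((1 - s ^ 2) / (2 * s))) ^ 2) = levelRoot c (s ^ 2) / (1 - s ^ 2) := by
    rw [levelRoot, ← Real.sqrt_sq hA.le, ← Real.sqrt_div (by rw [Real.sqrt_sq hA.le]; linarith),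
      Real.sqrt_sq hA.le]
    congr 1
    field_simp
    ring
  rw [hR, hroot, levelGrowth]
  have hT0 : 1 - s ^ 2 + levelRoot c (s ^ 2) ≠ 0 := by linarith
  field_simp
  nlinarith

/-- First and second derivatives of the radial rescaling `h • (x, y)`. -/
lemma deriv_radial {Γ : ℝ → ℝ × ℝ} {x y x' y' h h' : ℝ → ℝ} {x'' y'' h'' u t : ℝ}
    (hΓ : ∀ᶠ v in nhds u, Γ v = (t * x v * h v, t * y v * h v))
    (hx : ∀ v, HasDerivAt x (x' v) v) (hy : ∀ v, HasDerivAt y (y' v) v)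
    (hh : ∀ᶠ v in nhds u, HasDerivAt h (h' v) v)
    (hx' : HasDerivAt x' x'' u) (hy' : HasDerivAt y' y'' u) (hh' : HasDerivAt h' h'' u) :
    deriv Γ u = (t * (x' u * h u + x u * h' u), t * (y' u * h u + y u * h' u)) ∧
    deriv (deriv Γ) u = (t * (x'' * h u + 2 * (x' u * h' u) + x u * h''),
      t * (y'' * h u + 2 * (y' u * h' u) + y u * h'')) := by
  have h1 : ∀ᶠ v in nhds u,
      deriv Γ v = (t * (x' v * h v + x v * h' v), t * (y' v * h v + y v * h' v)) := by
    filter_upwards [hΓ.eventually_nhds, hh] with v hv hhv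
    refine (HasDerivAt.congr_of_eventuallyEq ?_ hv).deriv
    refine HasDerivAt.prodMk ?_ ?_
    · exact (((hx v).const_mul t).mul hhv).congr_deriv (by ring)
    · exact (((hy v).const_mul t).mul hhv).congr_deriv (by ring)
  refine ⟨h1.self_of_nhds, (HasDerivAt.congr_of_eventuallyEq ?_ h1).deriv⟩
  have hhu := hh.self_of_nhds
  refine HasDerivAt.prodMk ?_ ?_
  · exact (((hx'.mul hhu).add ((hx u).mul hh')).const_mul t).congr_deriv (by ring)
  · exact (((hy'.mul hhu).add ((hy u).mul hh')).const_mul t).congr_deriv (by ring)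

namespace Ribbon

variable (Rb : Ribbon)

/-- First coordinate of the ribbon. -/
def x (u : ℝ) : ℝ := (Rb.γ u).1

/-- Second coordinate of the ribbon. -/
def y (u : ℝ) : ℝ := (Rb.γ u).2

lemma contDiff_x : ContDiff ℝ (⊤ : ℕ∞) Rb.x := Rb.smooth.fst

lemma contDiff_y : ContDiff ℝ (⊤ : ℕ∞) Rb.y := Rb.smooth.snd

lemma hasDerivAt_x (u : ℝ) : HasDerivAt Rb.x (deriv Rb.x u) u :=
  (hasDerivAt_deriv_of_contDiff Rb.contDiff_x u).1

lemma hasDerivAt_y (u : ℝ) : HasDerivAt Rb.y (deriv Rb.y u) u :=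
  (hasDerivAt_deriv_of_contDiff Rb.contDiff_y u).1

lemma hasDerivAt_deriv_x (u : ℝ) : HasDerivAt (deriv Rb.x) (deriv (deriv Rb.x) u) u :=
  (hasDerivAt_deriv_of_contDiff Rb.contDiff_x u).2

lemma hasDerivAt_deriv_y (u : ℝ) : HasDerivAt (deriv Rb.y) (deriv (deriv Rb.y) u) u :=
  (hasDerivAt_deriv_of_contDiff Rb.contDiff_y u).2

lemma deriv_γ : deriv Rb.γ = fun u => (deriv Rb.x u, deriv Rb.y u) :=
  funext fun u => ((Rb.hasDerivAt_x u).prodMk (Rb.hasDerivAt_y u)).deriv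

lemma deriv_deriv_γ :
    deriv (deriv Rb.γ) = fun u => (deriv (deriv Rb.x) u, deriv (deriv Rb.y) u) := by
  rw [deriv_γ]
  exact funext fun u => ((Rb.hasDerivAt_deriv_x u).prodMk (Rb.hasDerivAt_deriv_y u)).deriv

/-- The curvature `det (γ', γ'')`. -/
def κ (u : ℝ) : ℝ :=
  deriv Rb.x u * deriv (deriv Rb.y) u - deriv Rb.y u * deriv (deriv Rb.x) u

/-- The angular momentum `det (γ, γ')`. -/
def areal (u : ℝ) : ℝ := Rb.x u * deriv Rb.y u - Rb.y u * deriv Rb.x u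

lemma det2_eq_κ : (fun u => det2 (deriv Rb.γ u) (deriv (deriv Rb.γ) u)) = Rb.κ := by
  funext u
  rw [deriv_deriv_γ, deriv_γ]
  rfl

lemma u₂_pos : 0 < Rb.u₂ := Rb.hu₁.trans Rb.h₁₂

lemma speed {u : ℝ} (hu : u ∈ Icc (-Rb.u₃) Rb.u₃) :
    deriv Rb.x u ^ 2 + deriv Rb.y u ^ 2 = 1 := by
  have := Rb.arclength u hu
  rw [deriv_γ, norm2, Real.sqrt_eq_one] at this
  exact this

lemma sq_norm_le_one {u : ℝ} (hu : u ∈ Icc (-Rb.u₃) Rb.u₃) : Rb.x u ^ 2 + Rb.y u ^ 2 ≤ 1 := by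
  have := Rb.inDisk u hu
  rw [norm2, Real.sqrt_le_one] at this
  exact this

lemma Icc_subset : Icc (-Rb.u₂) Rb.u₂ ⊆ Ioo (-Rb.u₃) Rb.u₃ := fun u hu =>
  ⟨by linarith [hu.1, Rb.h₂₃], by linarith [hu.2, Rb.h₂₃]⟩

lemma γ_u₂ : Rb.γ Rb.u₂ = (0, Rb.a) := by
  simpa using Rb.segment Rb.u₂ ⟨le_rfl, Rb.h₂₃.le⟩

lemma sq_norm_pos {u : ℝ} (hu : u ∈ Icc (-Rb.u₂) Rb.u₂) : 0 < Rb.x u ^ 2 + Rb.y u ^ 2 := by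
  have ha := Rb.ha.1
  rcases eq_or_lt_of_le hu.2 with h | h
  · rw [x, y, h, γ_u₂]
    simpa using pow_pos ha 2
  rcases eq_or_lt_of_le hu.1 with h' | h'
  · have := Rb.symm Rb.u₂ (Ioo_subset_Icc_self (Rb.Icc_subset ⟨by linarith, le_rfl⟩))
    rw [x, y, ← h', this, γ_u₂]
    simpa using pow_pos ha 2
  · have := (Rb.quadrant u ⟨h', h⟩).1.1
    exact add_pos_of_pos_of_nonneg (pow_pos this 2) (sq_nonneg _)

lemma deriv_orthogonal {u : ℝ} (hu : u ∈ Ioo (-Rb.u₃) Rb.u₃) :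
    deriv Rb.x u * deriv (deriv Rb.x) u + deriv Rb.y u * deriv (deriv Rb.y) u = 0 := by
  have h := ((Rb.hasDerivAt_deriv_x u).pow 2).add ((Rb.hasDerivAt_deriv_y u).pow 2)
  have h1 : (deriv Rb.x ^ 2 + deriv Rb.y ^ 2) =ᶠ[nhds u] fun _ => (1 : ℝ) := by
    filter_upwards [Ioo_mem_nhds hu.1 hu.2] with v hv
    exact Rb.speed (Ioo_subset_Icc_self hv)
  have := h.unique ((hasDerivAt_const u (1 : ℝ)).congr_of_eventuallyEq h1)
  norm_num at this
  linarith

lemma det_γ_deriv_deriv {u : ℝ} (hu : u ∈ Ioo (-Rb.u₃) Rb.u₃) :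
    Rb.x u * deriv (deriv Rb.y) u - Rb.y u * deriv (deriv Rb.x) u =
      Rb.κ u * (Rb.x u * deriv Rb.x u + Rb.y u * deriv Rb.y u) := by
  have h1 := Rb.deriv_orthogonal hu
  have h2 := Rb.speed (Ioo_subset_Icc_self hu)
  unfold κ
  linear_combination (Rb.x u * deriv Rb.y u - Rb.y u * deriv Rb.x u) * h1 -
    (Rb.x u * deriv (deriv Rb.y) u - Rb.y u * deriv (deriv Rb.x) u) * h2

lemma hasDerivAt_areal {u : ℝ} (hu : u ∈ Ioo (-Rb.u₃) Rb.u₃) :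
    HasDerivAt Rb.areal
      (Rb.κ u * (Rb.x u * deriv Rb.x u + Rb.y u * deriv Rb.y u)) u := by
  rw [← Rb.det_γ_deriv_deriv hu]
  exact (((Rb.hasDerivAt_x u).mul (Rb.hasDerivAt_deriv_y u)).sub
    ((Rb.hasDerivAt_y u).mul (Rb.hasDerivAt_deriv_x u))).congr_deriv (by ring)

lemma areal_u₂ : Rb.areal Rb.u₂ = 0 := by
  have hx : Rb.x Rb.u₂ = 0 := by rw [x, γ_u₂]
  have h0 : HasDerivWithinAt Rb.x 0 (Icc Rb.u₂ Rb.u₃) Rb.u₂ :=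
    (hasDerivWithinAt_const Rb.u₂ _ (0 : ℝ)).congr
      (fun v hv => by rw [x, Rb.segment v hv]) hx
  have hx' : deriv Rb.x Rb.u₂ = 0 :=
    (uniqueDiffOn_Icc Rb.h₂₃ Rb.u₂ ⟨le_rfl, Rb.h₂₃.le⟩).eq_deriv _
      (Rb.hasDerivAt_x Rb.u₂).hasDerivWithinAt h0
  rw [areal, hx, hx']
  ring

lemma abs_dot_le_one {u : ℝ} (hu : u ∈ Icc (-Rb.u₃) Rb.u₃) :
    |Rb.x u * deriv Rb.x u + Rb.y u * deriv Rb.y u| ≤ 1 := by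
  have h1 := Rb.speed hu
  have h2 := Rb.sq_norm_le_one hu
  rw [abs_le]
  constructor
  · nlinarith [sq_nonneg (Rb.x u + deriv Rb.x u), sq_nonneg (Rb.y u + deriv Rb.y u)]
  · nlinarith [sq_nonneg (Rb.x u - deriv Rb.x u), sq_nonneg (Rb.y u - deriv Rb.y u)]

lemma κ_pos {u : ℝ} (hu : u ∈ Ioo (-Rb.u₂) Rb.u₂) : 0 < Rb.κ u := by
  rw [← det2_eq_κ]
  exact Rb.convexArc u hu

/-- Near the end of the arc, the angular momentum is controlled by the curvature because the
curvature decreases. -/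
lemma abs_areal_le_of_mem_Ioo {u : ℝ} (hu : u ∈ Ioo Rb.u₁ Rb.u₂) :
    |Rb.areal u| ≤ Rb.u₂ * Rb.κ u := by
  have hu₁ := Rb.hu₁
  have hsub : ∀ v ∈ Icc u Rb.u₂, v ∈ Ioo (-Rb.u₃) Rb.u₃ := fun v hv =>
    Rb.Icc_subset ⟨by linarith [hv.1, hu.1, Rb.u₂_pos], hv.2⟩
  obtain ⟨ξ, hξ, he⟩ := exists_hasDerivAt_eq_slope Rb.areal _ hu.2
    (fun v hv => (Rb.hasDerivAt_areal (hsub v hv)).continuousAt.continuousWithinAt)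
    (fun v hv => Rb.hasDerivAt_areal (hsub v (Ioo_subset_Icc_self hv)))
  have hpos : 0 < Rb.u₂ - u := sub_pos.2 hu.2
  rw [areal_u₂, eq_div_iff hpos.ne'] at he
  have hκξ : Rb.κ ξ ≤ Rb.κ u := by
    have := Rb.curvDecreasing
    rw [det2_eq_κ] at this
    exact (this hu ⟨hu.1.trans hξ.1, hξ.2⟩ hξ.1).le
  have hκ0 := Rb.κ_pos (u := ξ) ⟨by linarith [hξ.1, hu.1, Rb.u₂_pos], hξ.2⟩
  have hdot := Rb.abs_dot_le_one (Ioo_subset_Icc_self (hsub ξ (Ioo_subset_Icc_self hξ)))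
  have : |Rb.areal u| = Rb.κ ξ * |Rb.x ξ * deriv Rb.x ξ + Rb.y ξ * deriv Rb.y ξ| *
      (Rb.u₂ - u) := by
    rw [← abs_neg, ← zero_sub, ← he, abs_mul, abs_mul, abs_of_pos hκ0, abs_of_pos hpos]
  rw [this]
  calc _ ≤ Rb.κ u * 1 * Rb.u₂ := by
        have hκu := hκ0.le.trans hκξ
        gcongr
        exact sub_le_self _ (hu₁.trans hu.1).le
    _ = _ := by ring

lemma deriv_x_neg {u : ℝ} (hu : u ∈ Ioo (-Rb.u₃) Rb.u₃) :
    deriv Rb.x (-u) = -deriv Rb.y u := by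
  have h : (fun v => Rb.x (-v)) =ᶠ[nhds u] Rb.y := by
    filter_upwards [Ioo_mem_nhds hu.1 hu.2] with v hv
    rw [x, Rb.symm v (Ioo_subset_Icc_self hv), y]
  rw [← h.deriv_eq, deriv_comp_neg, neg_neg]

lemma deriv_y_neg {u : ℝ} (hu : u ∈ Ioo (-Rb.u₃) Rb.u₃) :
    deriv Rb.y (-u) = -deriv Rb.x u := by
  have := Rb.deriv_x_neg (u := -u) ⟨by linarith [hu.2], by linarith [hu.1]⟩
  rw [neg_neg] at this
  rw [this, neg_neg]

lemma deriv_deriv_x_neg {u : ℝ} (hu : u ∈ Ioo (-Rb.u₃) Rb.u₃) :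
    deriv (deriv Rb.x) (-u) = deriv (deriv Rb.y) u := by
  have h : (fun v => deriv Rb.x (-v)) =ᶠ[nhds u] fun v => -deriv Rb.y v := by
    filter_upwards [Ioo_mem_nhds hu.1 hu.2] with v hv using Rb.deriv_x_neg hv
  have := h.deriv_eq
  rw [deriv_comp_neg, deriv.fun_neg] at this
  exact neg_injective this

lemma deriv_deriv_y_neg {u : ℝ} (hu : u ∈ Ioo (-Rb.u₃) Rb.u₃) :
    deriv (deriv Rb.y) (-u) = deriv (deriv Rb.x) u := by
  have := Rb.deriv_deriv_x_neg (u := -u) ⟨by linarith [hu.2], by linarith [hu.1]⟩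
  rw [neg_neg] at this
  exact this.symm

lemma κ_neg {u : ℝ} (hu : u ∈ Ioo (-Rb.u₃) Rb.u₃) : Rb.κ (-u) = Rb.κ u := by
  rw [κ, Rb.deriv_x_neg hu, Rb.deriv_y_neg hu, Rb.deriv_deriv_x_neg hu, Rb.deriv_deriv_y_neg hu, κ]
  ring

lemma areal_neg {u : ℝ} (hu : u ∈ Ioo (-Rb.u₃) Rb.u₃) : Rb.areal (-u) = Rb.areal u := by
  rw [areal, Rb.deriv_x_neg hu, Rb.deriv_y_neg hu, areal, x, y,
    Rb.symm u (Ioo_subset_Icc_self hu), x, y]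
  ring

lemma continuous_deriv_deriv_x : Continuous (deriv (deriv Rb.x)) :=
  (Rb.contDiff_x.iterate_deriv 2).continuous

lemma continuous_deriv_deriv_y : Continuous (deriv (deriv Rb.y)) :=
  (Rb.contDiff_y.iterate_deriv 2).continuous

lemma continuous_deriv_x : Continuous (deriv Rb.x) :=
  (Rb.contDiff_x.iterate_deriv 1).continuous

lemma continuous_deriv_y : Continuous (deriv Rb.y) :=
  (Rb.contDiff_y.iterate_deriv 1).continuous

lemma continuous_κ : Continuous Rb.κ :=
  (Rb.continuous_deriv_x.mul Rb.continuous_deriv_deriv_y).sub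
    (Rb.continuous_deriv_y.mul Rb.continuous_deriv_deriv_x)

lemma continuous_areal : Continuous Rb.areal :=
  (Rb.contDiff_x.continuous.mul Rb.continuous_deriv_y).sub
    (Rb.contDiff_y.continuous.mul Rb.continuous_deriv_x)

/-- On the whole arc, the angular momentum is dominated by the curvature. -/
lemma exists_abs_areal_le :
    ∃ C, 0 ≤ C ∧ ∀ u ∈ Ioo (-Rb.u₂) Rb.u₂, |Rb.areal u| ≤ C * Rb.κ u := by
  obtain ⟨w, hw₁, hw₂⟩ := exists_between Rb.h₁₂
  have hw0 := Rb.hu₁.trans hw₁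
  have hsub : ∀ u ∈ Icc (-w) w, u ∈ Ioo (-Rb.u₂) Rb.u₂ := fun u hu =>
    ⟨by linarith [hu.1], by linarith [hu.2]⟩
  obtain ⟨C, hC⟩ := isCompact_Icc.exists_bound_of_continuousOn (s := Icc (-w) w)
    (f := fun u => Rb.areal u / Rb.κ u)
    (Rb.continuous_areal.continuousOn.div Rb.continuous_κ.continuousOn
      fun u hu => (Rb.κ_pos (hsub u hu)).ne')
  refine ⟨max C Rb.u₂, le_max_of_le_right Rb.u₂_pos.le, fun u hu => ?_⟩
  have hκ := Rb.κ_pos hu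
  by_cases hm : u ∈ Icc (-w) w
  · have := hC u hm
    rw [Real.norm_eq_abs, abs_div, abs_of_pos hκ, div_le_iff₀ hκ] at this
    exact this.trans (mul_le_mul_of_nonneg_right (le_max_left _ _) hκ.le)
  · refine le_trans ?_ (mul_le_mul_of_nonneg_right (le_max_right C Rb.u₂) hκ.le)
    rcases lt_or_ge w u with h | h
    · exact Rb.abs_areal_le_of_mem_Ioo ⟨hw₁.trans h, hu.2⟩
    · have h' : u < -w := by
        by_contra hlt
        exact hm ⟨not_lt.1 hlt, h⟩
      have hu' := Rb.Icc_subset (Ioo_subset_Icc_self hu)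
      rw [← Rb.κ_neg hu', ← Rb.areal_neg hu']
      exact Rb.abs_areal_le_of_mem_Ioo ⟨by linarith, by linarith [hu.1]⟩

/-- The squared distance to the origin. -/
def sqNorm (u : ℝ) : ℝ := Rb.x u ^ 2 + Rb.y u ^ 2

/-- The derivative of `sqNorm`. -/
def sqNormDeriv (u : ℝ) : ℝ := 2 * (Rb.x u * deriv Rb.x u + Rb.y u * deriv Rb.y u)

/-- The second derivative of `sqNorm`. -/
def sqNormDeriv₂ (u : ℝ) : ℝ :=
  2 * (deriv Rb.x u ^ 2 + deriv Rb.y u ^ 2 +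
    (Rb.x u * deriv (deriv Rb.x) u + Rb.y u * deriv (deriv Rb.y) u))

lemma hasDerivAt_sqNorm (u : ℝ) : HasDerivAt Rb.sqNorm (Rb.sqNormDeriv u) u :=
  (((Rb.hasDerivAt_x u).pow 2).add ((Rb.hasDerivAt_y u).pow 2)).congr_deriv (by
    simp only [sqNormDeriv]; push_cast; ring)

lemma hasDerivAt_sqNormDeriv (u : ℝ) : HasDerivAt Rb.sqNormDeriv (Rb.sqNormDeriv₂ u) u :=
  ((((Rb.hasDerivAt_x u).mul (Rb.hasDerivAt_deriv_x u)).add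
    ((Rb.hasDerivAt_y u).mul (Rb.hasDerivAt_deriv_y u))).const_mul 2).congr_deriv (by
    simp only [sqNormDeriv₂]; ring)

lemma exists_abs_sqNormDeriv₂_le :
    ∃ M, 0 ≤ M ∧ ∀ u ∈ Icc (-Rb.u₂) Rb.u₂, |Rb.sqNormDeriv₂ u| ≤ M := by
  have hcont : Continuous Rb.sqNormDeriv₂ := by
    have h1 := Rb.continuous_deriv_x
    have h2 := Rb.continuous_deriv_y
    have h3 := Rb.continuous_deriv_deriv_x
    have h4 := Rb.continuous_deriv_deriv_y
    have h5 := Rb.contDiff_x.continuous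
    have h6 := Rb.contDiff_y.continuous
    unfold sqNormDeriv₂
    fun_prop
  obtain ⟨M, hM⟩ := isCompact_Icc.exists_bound_of_continuousOn (s := Icc (-Rb.u₂) Rb.u₂)
    hcont.continuousOn
  exact ⟨max M 0, le_max_right _ _, fun u hu => (hM u hu).trans (le_max_left _ _)⟩

lemma sqNormDeriv_abs_le {u : ℝ} (hu : u ∈ Icc (-Rb.u₂) Rb.u₂) : |Rb.sqNormDeriv u| ≤ 2 := by
  rw [sqNormDeriv, abs_mul, abs_two]
  linarith [Rb.abs_dot_le_one (Ioo_subset_Icc_self (Rb.Icc_subset hu))]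

/-- The first two derivatives of a level curve, in terms of those of its scaling factor
`h = 1 + G_t / (t‖γ‖)`; the factor has `h ∈ [1, 3]` and derivatives of size `O(t²)`. -/
lemma exists_level_curve_derivs {M t c u : ℝ} (ht : t ∈ Ioc (0 : ℝ) (1 / 20)) (hc : c ^ 2 ≤ 1)
    (hu : u ∈ Icc (-Rb.u₂) Rb.u₂) (hM : |Rb.sqNormDeriv₂ u| ≤ M) :
    ∃ h h' h'' : ℝ, h ∈ Icc (1 : ℝ) 3 ∧ |h'| ≤ 24 * t ^ 2 ∧ |h''| ≤ (12 * M + 1200) * t ^ 2 ∧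
      deriv (Γcurve Rb t c) u =
        (t * (deriv Rb.x u * h + Rb.x u * h'), t * (deriv Rb.y u * h + Rb.y u * h')) ∧
      deriv (deriv (Γcurve Rb t c)) u =
        (t * (deriv (deriv Rb.x) u * h + 2 * (deriv Rb.x u * h') + Rb.x u * h''),
          t * (deriv (deriv Rb.y) u * h + 2 * (deriv Rb.y u * h') + Rb.y u * h'')) := by
  obtain ⟨ht0, ht1⟩ := ht
  have ht2 : t ^ 2 ≤ 1 / 400 := by nlinarith
  have ht2' : 0 < t ^ 2 := by positivity
  have hρu : Rb.sqNorm u ∈ Ioo (0 : ℝ) 2 :=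
    ⟨Rb.sq_norm_pos hu,
      (Rb.sq_norm_le_one (Ioo_subset_Icc_self (Rb.Icc_subset hu))).trans_lt one_lt_two⟩
  have hq : ∀ v, Rb.sqNorm v ∈ Ioo (0 : ℝ) 2 → t ^ 2 * Rb.sqNorm v ∈ Ioo (0 : ℝ) (1 / 100) :=
    fun v hv => ⟨mul_pos ht2' hv.1, by nlinarith [hv.1, hv.2]⟩
  have hev : ∀ᶠ v in nhds u, Rb.sqNorm v ∈ Ioo (0 : ℝ) 2 :=
    (Rb.hasDerivAt_sqNorm u).continuousAt.eventually_mem (Ioo_mem_nhds hρu.1 hρu.2)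
  have hscale : ∀ v, HasDerivAt (fun v => t ^ 2 * Rb.sqNorm v) (t ^ 2 * Rb.sqNormDeriv v) v :=
    fun v => (Rb.hasDerivAt_sqNorm v).const_mul _
  have hΓ : ∀ᶠ v in nhds u, Γcurve Rb t c v =
      (t * Rb.x v * (1 + levelGrowth c (t ^ 2 * Rb.sqNorm v)),
        t * Rb.y v * (1 + levelGrowth c (t ^ 2 * Rb.sqNorm v))) := by
    filter_upwards [hev] with v hv
    have hs : 0 < t * norm2 (Rb.γ v) := mul_pos ht0 (Real.sqrt_pos.2 hv.1)
    have hsq : (t * norm2 (Rb.γ v)) ^ 2 = t ^ 2 * Rb.sqNorm v := by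
      rw [mul_pow]
      exact congrArg (t ^ 2 * ·) (Real.sq_sqrt hv.1.le)
    rw [Γcurve, Gt_div_eq_levelGrowth hc hs (by rw [hsq]; exact hq v hv), hsq]
    rfl
  have hh : ∀ᶠ v in nhds u, HasDerivAt (fun v => 1 + levelGrowth c (t ^ 2 * Rb.sqNorm v))
      (levelGrowthDeriv c (t ^ 2 * Rb.sqNorm v) * (t ^ 2 * Rb.sqNormDeriv v)) v := by
    filter_upwards [hev] with v hv
    exact ((hasDerivAt_levelGrowth hc (hq v hv)).comp v (hscale v)).const_add 1
  have hh' := ((hasDerivAt_levelGrowthDeriv hc (hq u hρu)).comp u (hscale u)).mul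
    ((Rb.hasDerivAt_sqNormDeriv u).const_mul (t ^ 2))
  obtain ⟨hd1, hd2⟩ := deriv_radial hΓ Rb.hasDerivAt_x Rb.hasDerivAt_y hh
    (Rb.hasDerivAt_deriv_x u) (Rb.hasDerivAt_deriv_y u) hh'
  have hX := levelGrowth_mem_Icc hc (hq u hρu)
  have hX1 := levelGrowthDeriv_mem_Icc hc (hq u hρu)
  have hX2 := abs_levelGrowthDeriv₂_le hc (hq u hρu)
  have hρ' := Rb.sqNormDeriv_abs_le hu
  refine ⟨_, _, _, ⟨by linarith [hX.1], by linarith [hX.2]⟩, ?_, ?_, hd1, hd2⟩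
  · rw [abs_mul, abs_mul, abs_of_nonneg hX1.1, abs_of_pos ht2']
    calc _ ≤ 12 * (t ^ 2 * 2) := by gcongr; exact hX1.2
      _ = _ := by ring
  · refine (abs_add_le _ _).trans ?_
    simp only [Function.comp_apply, abs_mul, abs_of_nonneg hX1.1, abs_of_pos ht2']
    have ht4 : t ^ 2 * t ^ 2 ≤ t ^ 2 := by nlinarith
    calc _ ≤ 300 * (t ^ 2 * 2) * (t ^ 2 * 2) + 12 * (t ^ 2 * M) := by
          gcongr
          exact hX1.2
      _ = 1200 * (t ^ 2 * t ^ 2) + 12 * M * t ^ 2 := by ring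
      _ ≤ _ := by linarith

lemma one_le_Rt {t u : ℝ} (ht : t ∈ Ioc (0 : ℝ) (1 / 20)) (hu : u ∈ Icc (-Rb.u₂) Rb.u₂) :
    1 ≤ Rt Rb t u := by
  have hn0 : 0 < norm2 (Rb.γ u) := Real.sqrt_pos.2 (Rb.sq_norm_pos hu)
  have hn1 := Rb.inDisk u (Ioo_subset_Icc_self (Rb.Icc_subset hu))
  have hs : 0 < t * norm2 (Rb.γ u) := mul_pos ht.1 hn0
  have hs1 : t * norm2 (Rb.γ u) ≤ 1 / 20 := by nlinarith [ht.1, ht.2]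
  have : 20 ≤ 1 / (t * norm2 (Rb.γ u)) := by
    rw [le_div_iff₀ hs]
    linarith
  unfold Rt
  linarith

end Ribbon

/-- **Convexity of the horizontal level curves (from Proposition 3.3).** For every ribbon `γ`
there is `t₀ ∈ (0,1]` such that for all `t ∈ (0,t₀]` and `c ∈ [-1,1]`: `R_t(u) ≥ 1` on
`[-u₂,u₂]`, the curve `Γ_{t,c}` is regular there, and `det(Γ'_{t,c}(u), Γ''_{t,c}(u)) > 0` on
`(-u₂,u₂)`. -/
theorem level_curves_strictly_convex (Rb : Ribbon) :
    ∃ t₀ ∈ Set.Ioc (0 : ℝ) 1, ∀ t ∈ Set.Ioc (0 : ℝ) t₀, ∀ c ∈ Set.Icc (-1 : ℝ) 1,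
      (∀ u ∈ Set.Icc (-Rb.u₂) Rb.u₂, 1 ≤ Rt Rb t u) ∧
      (∀ u ∈ Set.Icc (-Rb.u₂) Rb.u₂, deriv (Γcurve Rb t c) u ≠ 0) ∧
      (∀ u ∈ Set.Ioo (-Rb.u₂) Rb.u₂,
        0 < det2 (deriv (Γcurve Rb t c) u) (deriv (deriv (Γcurve Rb t c)) u)) := by
  obtain ⟨C, hC0, hC⟩ := Rb.exists_abs_areal_le
  obtain ⟨M, hM0, hM⟩ := Rb.exists_abs_sqNormDeriv₂_le
  set B : ℝ := C * (2 * 24 ^ 2 + 3 * (12 * M + 1200)) + 100 with hB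
  have hB100 : 100 ≤ B := by
    have : 0 ≤ C * (2 * 24 ^ 2 + 3 * (12 * M + 1200)) := by positivity
    linarith
  have hB0 : 0 < B := by linarith
  refine ⟨1 / B, ⟨by positivity, by rw [div_le_one hB0]; linarith⟩, fun t ht c hc => ?_⟩
  have htB : t * B ≤ 1 := (le_div_iff₀ hB0).1 ht.2
  have ht' : t ∈ Ioc (0 : ℝ) (1 / 20) := ⟨ht.1, by nlinarith [ht.1]⟩
  have hc2 : c ^ 2 ≤ 1 := by nlinarith [hc.1, hc.2]
  have ht2 : 0 < t ^ 2 := pow_pos ht.1 2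
  have ht2B : t ^ 2 * B < 1 := by nlinarith [ht.1, ht'.2]
  have ht21 : t ^ 2 ≤ 1 / 400 := by nlinarith [ht.1, ht'.2]
  refine ⟨fun u hu => Rb.one_le_Rt ht' hu, fun u hu h0 => ?_, fun u hu => ?_⟩
  · obtain ⟨h, h', h'', hh, hh', -, hd, -⟩ := Rb.exists_level_curve_derivs ht' hc2 hu (hM u hu)
    have hu3 := Ioo_subset_Icc_self (Rb.Icc_subset hu)
    rw [hd, Prod.mk_eq_zero, mul_eq_zero, mul_eq_zero, or_iff_right ht.1.ne',
      or_iff_right ht.1.ne'] at h0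
    have hsp := Rb.speed hu3
    have hdot := Rb.abs_dot_le_one hu3
    have hz : h = -h' * (Rb.x u * deriv Rb.x u + Rb.y u * deriv Rb.y u) := by
      linear_combination deriv Rb.x u * h0.1 + deriv Rb.y u * h0.2 - h * hsp
    have : |h| ≤ 24 * t ^ 2 * 1 := by
      rw [hz, abs_mul, abs_neg]
      gcongr
    linarith [le_abs_self h, hh.1]
  · have hu2 := Ioo_subset_Icc_self hu
    obtain ⟨h, h', h'', hh, hh', hh'', hd, hd2⟩ :=
      Rb.exists_level_curve_derivs ht' hc2 hu2 (hM u hu2)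
    have hκ := Rb.κ_pos hu
    have hdet := Rb.det_γ_deriv_deriv (Rb.Icc_subset hu2)
    have hdot := Rb.abs_dot_le_one (Ioo_subset_Icc_self (Rb.Icc_subset hu2))
    have hD := hC u hu
    set p := Rb.x u * deriv Rb.x u + Rb.y u * deriv Rb.y u
    have hfactor : det2 (deriv (Γcurve Rb t c) u) (deriv (deriv (Γcurve Rb t c)) u) =
        t ^ 2 * (Rb.κ u * h ^ 2 + (Rb.areal u * (2 * h' ^ 2 - h * h'') +
          Rb.κ u * (h * h' * p))) := by
      rw [hd, hd2, det2]
      simp only [Ribbon.κ, Ribbon.areal] at hdet ⊢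
      linear_combination t ^ 2 * h * h' * hdet
    have h3 : |h| ≤ 3 := abs_le.2 ⟨by linarith [hh.1], hh.2⟩
    have ht4 : t ^ 2 * t ^ 2 ≤ t ^ 2 := by nlinarith
    have hrad : |2 * h' ^ 2 - h * h''| ≤ (2 * 24 ^ 2 + 3 * (12 * M + 1200)) * t ^ 2 := by
      refine (abs_sub _ _).trans ?_
      rw [abs_mul, abs_mul, abs_pow, abs_two]
      calc _ ≤ 2 * (24 * t ^ 2) ^ 2 + 3 * ((12 * M + 1200) * t ^ 2) := by gcongr
        _ = 2 * 24 ^ 2 * (t ^ 2 * t ^ 2) + 3 * ((12 * M + 1200) * t ^ 2) := by ring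
        _ ≤ _ := by linarith
    have herr : |Rb.areal u * (2 * h' ^ 2 - h * h'') + Rb.κ u * (h * h' * p)| ≤
        Rb.κ u * (t ^ 2 * B) := by
      refine (abs_add_le _ _).trans ?_
      rw [abs_mul, abs_mul, abs_mul, abs_mul, abs_of_pos hκ]
      calc _ ≤ C * Rb.κ u * ((2 * 24 ^ 2 + 3 * (12 * M + 1200)) * t ^ 2) +
            Rb.κ u * (3 * (24 * t ^ 2) * 1) := by gcongr
        _ ≤ _ := by
          rw [hB]
          nlinarith [mul_pos hκ ht2]
    have hmain : Rb.κ u ≤ Rb.κ u * h ^ 2 :=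
      le_mul_of_one_le_right hκ.le (one_le_pow₀ hh.1)
    have hsmall : Rb.κ u * (t ^ 2 * B) < Rb.κ u := mul_lt_of_lt_one_right hκ ht2B
    rw [hfactor]
    exact mul_pos ht2 (by linarith [(abs_le.1 herr).1])
end
end
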